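/- Let (R, m) be a commutative Noetherian local ring with dim R = d. Then the following are equivalent: (i) R is a Cohen-Macaulay ring; (ii) fd_R H^d_m(R) = d; (iii) pd_R H^d_m(R) = d. -/

import Mathlib

/-!
Definitions needed to state results of "On flat and Gorenstein flat dimensions of
local cohomology modules" by M.R. Zargar and H. Zakeri.
-/

open CategoryTheory IsLocalRing

universe u

namespace Paper

variable (R : Type u) [CommRing R]

/-! ## Resolution/coresolution dimensions with respect to a class of modules -/

/-- `ResDimLE R P n M` : `M` admits a resolution `0 → Xₙ → ⋯ → X₀ → M → 0`
with each `Xᵢ` in the class `P`. -/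
def ResDimLE (P : ModuleCat.{u} R → Prop) : ℕ → ModuleCat.{u} R → Prop
  | 0, M => P M
  | n + 1, M => ResDimLE P n M ∨
      ∃ (X : ModuleCat.{u} R) (f : X →ₗ[R] M), P X ∧ Function.Surjective f ∧
        ResDimLE P n (ModuleCat.of R (LinearMap.ker f))

/-- `CoresDimLE R P n M` : `M` admits a coresolution `0 → M → X₀ → ⋯ → Xₙ → 0`
with each `Xᵢ` in the class `P`. -/
def CoresDimLE (P : ModuleCat.{u} R → Prop) : ℕ → ModuleCat.{u} R → Prop
  | 0, M => P M
  | n + 1, M => CoresDimLE P n M ∨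
      ∃ (X : ModuleCat.{u} R) (f : M →ₗ[R] X), P X ∧ Function.Injective f ∧
        CoresDimLE P n (ModuleCat.of R (X ⧸ LinearMap.range f))

/-- The resolution dimension of `M` with respect to the class `P`, as an
extended natural number (`⊤` if there is no finite resolution). -/
noncomputable def ResDim (P : ModuleCat.{u} R → Prop) (M : ModuleCat.{u} R) : ℕ∞ :=
  sInf {n : ℕ∞ | ∃ k : ℕ, (k : ℕ∞) = n ∧ ResDimLE R P k M}

/-- The coresolution dimension of `M` with respect to the class `P`. -/
noncomputable def CoresDim (P : ModuleCat.{u} R → Prop) (M : ModuleCat.{u} R) : ℕ∞ :=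
  sInf {n : ℕ∞ | ∃ k : ℕ, (k : ℕ∞) = n ∧ CoresDimLE R P k M}

/-- Flat dimension `fd_R M`. -/
noncomputable def flatDim (M : Type u) [AddCommGroup M] [Module R M] : ℕ∞ :=
  ResDim R (fun N => Module.Flat R N) (ModuleCat.of R M)

/-- Projective dimension `pd_R M`. -/
noncomputable def projDim (M : Type u) [AddCommGroup M] [Module R M] : ℕ∞ :=
  ResDim R (fun N => Module.Projective R N) (ModuleCat.of R M)

/-- Injective dimension `id_R M`. -/
noncomputable def injDim (M : Type u) [AddCommGroup M] [Module R M] : ℕ∞ :=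
  CoresDim R (fun N => Module.Injective R N) (ModuleCat.of R M)

/-! ## Local cohomology -/

/-- The local cohomology module `H^i_𝔞(M)`, as an object of `ModuleCat R`. -/
noncomputable def lcoh (𝔞 : Ideal R) (i : ℕ) (M : Type u) [AddCommGroup M] [Module R M] :
    ModuleCat.{u} R :=
  (localCohomology 𝔞 i).obj (ModuleCat.of R M)

/-- `M` is relative Cohen-Macaulay with respect to `𝔞` with `ht_M 𝔞 = n`, i.e. the
`n`-th local cohomology of `M` with respect to `𝔞` is the only non-vanishing one. -/
def IsRelCM (𝔞 : Ideal R) (n : ℕ) (M : Type u) [AddCommGroup M] [Module R M] : Prop :=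
  (∀ i : ℕ, i ≠ n → Subsingleton (lcoh R 𝔞 i M)) ∧ ¬ Subsingleton (lcoh R 𝔞 n M)

/-! ## Depth, dimension, Cohen-Macaulay -/

/-- The depth of a module over a local ring: the supremum of the lengths of
`M`-regular sequences contained in the maximal ideal. -/
noncomputable def depth [IsLocalRing R] (M : Type u) [AddCommGroup M] [Module R M] : ℕ∞ :=
  sSup {n : ℕ∞ | ∃ rs : List R, (rs.length : ℕ∞) = n ∧ (∀ x ∈ rs, x ∈ maximalIdeal R) ∧
    RingTheory.Sequence.IsRegular M rs}

/-- The (Krull) dimension of a module: the Krull dimension of `R` modulo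
the annihilator of `M` (`⊥` for the zero module). -/
noncomputable def moduleDim (M : Type u) [AddCommGroup M] [Module R M] : WithBot ℕ∞ :=
  ringKrullDim (R ⧸ Module.annihilator R M)

/-- A finitely generated module over a local ring is Cohen-Macaulay
if its depth equals its dimension. -/
def IsCohenMacaulayModule [IsLocalRing R] (M : Type u) [AddCommGroup M] [Module R M] : Prop :=
  (depth R M : WithBot ℕ∞) = moduleDim R M

/-- A local ring is Cohen-Macaulay if it is so as a module over itself. -/
def IsCohenMacaulayRing [IsLocalRing R] : Prop := IsCohenMacaulayModule R R

/-- A local ring is Gorenstein if it has finite injective dimension over itself. -/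
def IsGorensteinRing : Prop := injDim R R ≠ ⊤

/-! ## Ext, Tor, semidualizing modules -/

/-- `Ext^i_R(A, B)`. -/
noncomputable def ext (i : ℕ) (A B : Type u) [AddCommGroup A] [Module R A]
    [AddCommGroup B] [Module R B] : ModuleCat.{u} R :=
  ((Ext R (ModuleCat.{u} R) i).obj (Opposite.op (ModuleCat.of R A))).obj (ModuleCat.of R B)

/-- `Tor^R_p(A, B)` indexed by `p : ℤ`, with the convention that it vanishes in
negative degrees. -/
noncomputable def tor (p : ℤ) (A B : Type u) [AddCommGroup A] [Module R A]
    [AddCommGroup B] [Module R B] : ModuleCat.{u} R :=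
  if 0 ≤ p then ((Tor (ModuleCat.{u} R) p.toNat).obj (ModuleCat.of R A)).obj (ModuleCat.of R B)
  else ModuleCat.of R PUnit

/-- A finitely generated module `C` is semidualizing if the natural map
`R → Hom_R(C, C)` is bijective and `Ext^i_R(C, C) = 0` for all `i ≥ 1`. -/
def IsSemidualizing (C : Type u) [AddCommGroup C] [Module R C] : Prop :=
  Module.Finite R C ∧
  Function.Bijective (fun r : R => (r • LinearMap.id : C →ₗ[R] C)) ∧
  ∀ i : ℕ, 1 ≤ i → Subsingleton (ext R i C C)

/-! ## Gorenstein homological classes -/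

/-- `N` is Gorenstein injective: it is the kernel of the `0`-th differential of some
exact complex `Y` of injective modules which stays exact under `Hom(I, -)` for every
injective module `I`. (The complex is written cohomologically.) -/
def IsGorensteinInjective (N : Type u) [AddCommGroup N] [Module R N] : Prop :=
  ∃ (Y : ℤ → ModuleCat.{u} R) (d : ∀ i : ℤ, Y i →ₗ[R] Y (i + 1)),
    (∀ i, Module.Injective R (Y i)) ∧
    (∀ i, Function.Exact (d i) (d (i + 1))) ∧
    (∀ (I : ModuleCat.{u} R), Module.Injective R I →
      ∀ (i : ℤ) (g : I →ₗ[R] Y (i + 1)), (d (i + 1)).comp g = 0 →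
        ∃ h : I →ₗ[R] Y i, (d i).comp h = g) ∧
    ∃ ι : N →ₗ[R] Y 0, Function.Injective ι ∧ Function.Exact ι (d 0)

/-- `N` is Gorenstein projective: it is the cokernel of a differential of some
exact complex `X` of projective modules which stays exact under `Hom(-, P)` for
every projective module `P`. -/
def IsGorensteinProjective (N : Type u) [AddCommGroup N] [Module R N] : Prop :=
  ∃ (X : ℤ → ModuleCat.{u} R) (d : ∀ i : ℤ, X i →ₗ[R] X (i + 1)),
    (∀ i, Module.Projective R (X i)) ∧
    (∀ i, Function.Exact (d i) (d (i + 1))) ∧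
    (∀ (P : ModuleCat.{u} R), Module.Projective R P →
      ∀ (i : ℤ) (g : X (i + 1) →ₗ[R] P), g.comp (d i) = 0 →
        ∃ h : X (i + 1 + 1) →ₗ[R] P, h.comp (d (i + 1)) = g) ∧
    ∃ π : X 0 →ₗ[R] N, Function.Surjective π ∧ Function.Exact (d (-1)) π

/-- `N` is Gorenstein flat: it is the cokernel of a differential of some exact
complex `Z` of flat modules which stays exact under `- ⊗ I` for every injective
module `I`. -/
def IsGorensteinFlat (N : Type u) [AddCommGroup N] [Module R N] : Prop :=
  ∃ (Z : ℤ → ModuleCat.{u} R) (d : ∀ i : ℤ, Z i →ₗ[R] Z (i + 1)),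
    (∀ i, Module.Flat R (Z i)) ∧
    (∀ i, Function.Exact (d i) (d (i + 1))) ∧
    (∀ (I : ModuleCat.{u} R), Module.Injective R I →
      ∀ i : ℤ, Function.Exact (LinearMap.rTensor (R := R) I (d i))
        (LinearMap.rTensor (R := R) I (d (i + 1)))) ∧
    ∃ π : Z 0 →ₗ[R] N, Function.Surjective π ∧ Function.Exact (d (-1)) π

/-- Gorenstein injective dimension `Gid_R M`. -/
noncomputable def GinjDim (M : Type u) [AddCommGroup M] [Module R M] : ℕ∞ :=
  CoresDim R (fun N => IsGorensteinInjective R N) (ModuleCat.of R M)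

/-- Gorenstein projective dimension `Gpd_R M`. -/
noncomputable def GprojDim (M : Type u) [AddCommGroup M] [Module R M] : ℕ∞ :=
  ResDim R (fun N => IsGorensteinProjective R N) (ModuleCat.of R M)

/-- Gorenstein flat dimension `Gfd_R M`. -/
noncomputable def GflatDim (M : Type u) [AddCommGroup M] [Module R M] : ℕ∞ :=
  ResDim R (fun N => IsGorensteinFlat R N) (ModuleCat.of R M)

/-! ## `C`-injective, `C`-projective, `C`-flat modules and the `G_C`-classes -/

/-- `N` is `C`-injective if `N ≅ Hom_R(C, I)` for some injective module `I`. -/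
def IsCInjective (C : Type u) [AddCommGroup C] [Module R C]
    (N : Type u) [AddCommGroup N] [Module R N] : Prop :=
  ∃ I : ModuleCat.{u} R, Module.Injective R I ∧ Nonempty (N ≃ₗ[R] (C →ₗ[R] I))

/-- `N` is `C`-projective if `N ≅ C ⊗_R P` for some projective module `P`. -/
def IsCProjective (C : Type u) [AddCommGroup C] [Module R C]
    (N : Type u) [AddCommGroup N] [Module R N] : Prop :=
  ∃ P : ModuleCat.{u} R, Module.Projective R P ∧ Nonempty (N ≃ₗ[R] TensorProduct R C P)

/-- `N` is `C`-flat if `N ≅ C ⊗_R F` for some flat module `F`. -/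
def IsCFlat (C : Type u) [AddCommGroup C] [Module R C]
    (N : Type u) [AddCommGroup N] [Module R N] : Prop :=
  ∃ F : ModuleCat.{u} R, Module.Flat R F ∧ Nonempty (N ≃ₗ[R] TensorProduct R C F)

/-- `C`-injective dimension `cid_R M`. -/
noncomputable def cInjDim (C : Type u) [AddCommGroup C] [Module R C]
    (M : Type u) [AddCommGroup M] [Module R M] : ℕ∞ :=
  CoresDim R (fun N => IsCInjective R C N) (ModuleCat.of R M)

/-- `C`-projective dimension `cpd_R M`. -/
noncomputable def cProjDim (C : Type u) [AddCommGroup C] [Module R C]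
    (M : Type u) [AddCommGroup M] [Module R M] : ℕ∞ :=
  ResDim R (fun N => IsCProjective R C N) (ModuleCat.of R M)

/-- `N` is `G_C`-injective: `N` is the kernel of the `0`-th differential of an exact
complex `Y` (a complete `I_C I`-coresolution) with `Y i` injective in degrees belonging
to the coresolution part and `C`-injective elsewhere, such that `Hom(I', Y)` is exact
for every `C`-injective module `I'`. -/
def IsGCInjective (C : Type u) [AddCommGroup C] [Module R C]
    (N : Type u) [AddCommGroup N] [Module R N] : Prop :=
  ∃ (Y : ℤ → ModuleCat.{u} R) (d : ∀ i : ℤ, Y i →ₗ[R] Y (i + 1)),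
    (∀ i : ℤ, 0 ≤ i → Module.Injective R (Y i)) ∧
    (∀ i : ℤ, i < 0 → IsCInjective R C (Y i)) ∧
    (∀ i, Function.Exact (d i) (d (i + 1))) ∧
    (∀ (I : ModuleCat.{u} R), IsCInjective R C I →
      ∀ (i : ℤ) (g : I →ₗ[R] Y (i + 1)), (d (i + 1)).comp g = 0 →
        ∃ h : I →ₗ[R] Y i, (d i).comp h = g) ∧
    ∃ ι : N →ₗ[R] Y 0, Function.Injective ι ∧ Function.Exact ι (d 0)

/-- `N` is `G_C`-projective: the cokernel of the degree `0` differential of a complete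
`P_C P`-resolution. -/
def IsGCProjective (C : Type u) [AddCommGroup C] [Module R C]
    (N : Type u) [AddCommGroup N] [Module R N] : Prop :=
  ∃ (X : ℤ → ModuleCat.{u} R) (d : ∀ i : ℤ, X i →ₗ[R] X (i + 1)),
    (∀ i : ℤ, i ≤ 0 → Module.Projective R (X i)) ∧
    (∀ i : ℤ, 0 < i → IsCProjective R C (X i)) ∧
    (∀ i, Function.Exact (d i) (d (i + 1))) ∧
    (∀ (Q : ModuleCat.{u} R), IsCProjective R C Q →
      ∀ (i : ℤ) (g : X (i + 1) →ₗ[R] Q), g.comp (d i) = 0 →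
        ∃ h : X (i + 1 + 1) →ₗ[R] Q, h.comp (d (i + 1)) = g) ∧
    ∃ π : X 0 →ₗ[R] N, Function.Surjective π ∧ Function.Exact (d (-1)) π

/-- `N` is `G_C`-flat: the cokernel of the degree `0` differential of a complete
`F_C F`-resolution. -/
def IsGCFlat (C : Type u) [AddCommGroup C] [Module R C]
    (N : Type u) [AddCommGroup N] [Module R N] : Prop :=
  ∃ (Z : ℤ → ModuleCat.{u} R) (d : ∀ i : ℤ, Z i →ₗ[R] Z (i + 1)),
    (∀ i : ℤ, i ≤ 0 → Module.Flat R (Z i)) ∧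
    (∀ i : ℤ, 0 < i → IsCFlat R C (Z i)) ∧
    (∀ i, Function.Exact (d i) (d (i + 1))) ∧
    (∀ (J : ModuleCat.{u} R), IsCInjective R C J →
      ∀ i : ℤ, Function.Exact (LinearMap.rTensor (R := R) J (d i))
        (LinearMap.rTensor (R := R) J (d (i + 1)))) ∧
    ∃ π : Z 0 →ₗ[R] N, Function.Surjective π ∧ Function.Exact (d (-1)) π

/-- `G_C`-injective dimension `Gid_C M`. -/
noncomputable def GCinjDim (C : Type u) [AddCommGroup C] [Module R C]
    (M : Type u) [AddCommGroup M] [Module R M] : ℕ∞ :=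
  CoresDim R (fun N => IsGCInjective R C N) (ModuleCat.of R M)

/-- `G_C`-projective dimension `G_C-pd_R M`. -/
noncomputable def GCprojDim (C : Type u) [AddCommGroup C] [Module R C]
    (M : Type u) [AddCommGroup M] [Module R M] : ℕ∞ :=
  ResDim R (fun N => IsGCProjective R C N) (ModuleCat.of R M)

/-- `G_C`-flat dimension `G_C-fd_R M`. -/
noncomputable def GCflatDim (C : Type u) [AddCommGroup C] [Module R C]
    (M : Type u) [AddCommGroup M] [Module R M] : ℕ∞ :=
  ResDim R (fun N => IsGCFlat R C N) (ModuleCat.of R M)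

end Paper


open Paper

namespace CMProof

section P1
variable {R : Type u} [CommRing R]

/-- Character module as object -/
noncomputable abbrev ch (M : ModuleCat.{u} R) : ModuleCat.{u} R :=
  ModuleCat.of R (CharacterModule M)

/-- dual map -/
noncomputable abbrev chMap {M N : ModuleCat.{u} R} (f : M ⟶ N) : ch N ⟶ ch M :=
  ModuleCat.ofHom (CharacterModule.dual f.hom)

lemma flat_iff_injective_ch (M : ModuleCat.{u} R) :
    Module.Flat R M ↔ Injective (ch M) := by
  rw [Module.Flat.iff_characterModule_injective, Module.injective_iff_injective_object]

/-- dual short complex -/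
noncomputable def chSC (S : ShortComplex (ModuleCat.{u} R)) : ShortComplex (ModuleCat.{u} R) :=
  ShortComplex.mk (chMap S.g) (chMap S.f) (by
    ext φ x
    have h : S.g.hom (S.f.hom x) = 0 := congrArg (fun g => g.hom x) S.zero
    change φ (S.g.hom (S.f.hom x)) = 0
    rw [h, map_zero])

lemma chSC_shortExact {S : ShortComplex (ModuleCat.{u} R)} (hS : S.ShortExact) :
    (chSC S).ShortExact := by
  have hex := hS.exact
  rw [ShortComplex.ShortExact.moduleCat_exact_iff_function_exact] at hex
  have hi := hS.moduleCat_injective_f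
  have hs := hS.moduleCat_surjective_g
  refine ShortComplex.ShortExact.mk' ?_ ?_ ?_
  · rw [ShortComplex.ShortExact.moduleCat_exact_iff_function_exact]
    intro (φ : CharacterModule S.X₂)
    constructor
    · intro (hφ : CharacterModule.dual S.f.hom φ = 0)
      have hφ' : ∀ x, φ (S.f.hom x) = 0 := fun x => DFunLike.congr_fun hφ x
      have key : ∀ y y' : S.X₂, S.g.hom y = S.g.hom y' → φ y = φ y' := by
        intro y y' h
        have h2 : S.g.hom (y - y') = 0 := by rw [map_sub, h, sub_self]
        obtain ⟨x, hx⟩ := (hex _).1 h2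
        have h3 : φ (y - y') = 0 := by rw [← hx]; exact hφ' x
        rwa [map_sub, sub_eq_zero] at h3
      refine ⟨AddMonoidHom.mk' (fun z => φ (hs z).choose) ?_, ?_⟩
      · intro a b
        rw [← map_add]
        apply key
        rw [map_add]
        erw [(hs (a+b)).choose_spec, (hs a).choose_spec, (hs b).choose_spec]
      · refine CharacterModule.ext (A := S.X₂) fun y => ?_
        exact key _ _ (hs (S.g.hom y)).choose_spec
    · rintro ⟨ψ, rfl⟩
      exact congrArg (fun g => g.hom ψ) (chSC S).zero
  · rw [ModuleCat.mono_iff_injective]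
    exact CharacterModule.dual_injective_of_surjective _ hs
  · rw [ModuleCat.epi_iff_surjective]
    exact CharacterModule.dual_surjective_of_injective _ hi


lemma resDimLE_proj_iff (n : ℕ) (M : ModuleCat.{u} R) :
    ResDimLE R (fun N => Module.Projective R N) n M ↔ HasProjectiveDimensionLT M (n + 1) := by
  induction n generalizing M with
  | zero =>
    change Module.Projective R M ↔ _
    rw [IsProjective.iff_projective, projective_iff_hasProjectiveDimensionLT_one]
  | succ n ih =>
    constructor
    · rintro (h | ⟨X, f, hX, hf, h⟩)
      · have := (ih M).1 h
        exact hasProjectiveDimensionLT_of_ge M (n+1) _ (by omega)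
      · have h1 := (ih _).1 h
        have hS := LinearMap.shortExact_shortComplexKer hf
        have hX' : Projective X := (IsProjective.iff_projective X).1 hX
        exact (hS.hasProjectiveDimensionLT_X₃_iff n hX').2 h1
    · intro h
      right
      have hS := ModuleCat.shortExact_projectiveShortComplex M
      let P := Projective.over M
      have hs : Function.Surjective (Projective.π M).hom :=
        (ModuleCat.epi_iff_surjective _).1 inferInstance
      refine ⟨P, (Projective.π M).hom, (IsProjective.iff_projective P).2
        (Projective.projective_over M), hs, (ih _).2 ?_⟩
      have hS := LinearMap.shortExact_shortComplexKer hs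
      exact (hS.hasProjectiveDimensionLT_X₃_iff n (Projective.projective_over M)).1 h

lemma resDimLE_flat_iff (n : ℕ) (M : ModuleCat.{u} R) :
    ResDimLE R (fun N => Module.Flat R N) n M ↔ HasInjectiveDimensionLT (ch M) (n + 1) := by
  induction n generalizing M with
  | zero =>
    change Module.Flat R M ↔ _
    rw [flat_iff_injective_ch, injective_iff_hasInjectiveDimensionLT_one]
  | succ n ih =>
    constructor
    · rintro (h | ⟨X, f, hX, hf, h⟩)
      · have := (ih M).1 h
        exact hasInjectiveDimensionLT_of_ge _ (n+1) _ (by omega)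
      · have h1 := (ih _).1 h
        have hS := chSC_shortExact (LinearMap.shortExact_shortComplexKer hf)
        exact (hS.hasInjectiveDimensionLT_X₃_iff n ((flat_iff_injective_ch X).1 hX)).1 h1
    · intro h
      right
      let P := Projective.over M
      have hs : Function.Surjective (Projective.π M).hom :=
        (ModuleCat.epi_iff_surjective _).1 inferInstance
      have hP : Module.Projective R P := (IsProjective.iff_projective P).2
        (Projective.projective_over M)
      have hF : Module.Flat R P := inferInstance
      refine ⟨P, (Projective.π M).hom, hF, hs, (ih _).2 ?_⟩
      have hS := chSC_shortExact (LinearMap.shortExact_shortComplexKer hs)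
      exact (hS.hasInjectiveDimensionLT_X₃_iff n ((flat_iff_injective_ch P).1 hF)).2 h

lemma resDimLE_mono (P Q : ModuleCat.{u} R → Prop) (h : ∀ M, P M → Q M) (n : ℕ)
    (M : ModuleCat.{u} R) (hM : ResDimLE R P n M) : ResDimLE R Q n M := by
  induction n generalizing M with
  | zero => exact h _ hM
  | succ n ih =>
    rcases hM with hM | ⟨X, f, hX, hf, h'⟩
    · exact Or.inl (ih _ hM)
    · exact Or.inr ⟨X, f, h _ hX, hf, ih _ h'⟩

/-- pd M ≤ n implies id M⁺ ≤ n. -/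
lemma injDimLT_ch (M : ModuleCat.{u} R) (n : ℕ) (h : HasProjectiveDimensionLT M (n + 1)) :
    HasInjectiveDimensionLT (ch M) (n + 1) :=
  (resDimLE_flat_iff n M).1 (resDimLE_mono _ _ (fun N (_ : Module.Projective R N) =>
    (inferInstance : Module.Flat R N)) n M ((resDimLE_proj_iff n M).2 h))

lemma resDim_eq_iff (P : ModuleCat.{u} R → Prop) (M : ModuleCat.{u} R) (n : ℕ) :
    ResDim R P M = n ↔ ResDimLE R P n M ∧ ∀ k < n, ¬ ResDimLE R P k M := by
  have hmono : ∀ a, ResDimLE R P a M → ResDimLE R P (a+1) M := fun a h => Or.inl h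
  have hmono' : ∀ a b, a ≤ b → ResDimLE R P a M → ResDimLE R P b M := by
    intro a b hab h
    induction b, hab using Nat.le_induction with
    | base => exact h
    | succ b _ ih => exact hmono _ ih
  constructor
  · intro h
    unfold ResDim at h
    constructor
    · have hne : {n : ℕ∞ | ∃ k : ℕ, (k : ℕ∞) = n ∧ ResDimLE R P k M}.Nonempty := by
        by_contra hc
        rw [Set.not_nonempty_iff_eq_empty] at hc
        rw [hc, sInf_empty] at h
        exact (ENat.natCast_ne_top n) h.symm
      have := csInf_mem hne
      rw [h] at this
      obtain ⟨k, hk, hk'⟩ := this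
      have : k = n := by exact_mod_cast hk
      exact this ▸ hk'
    · intro k hk hk'
      have : sInf {n : ℕ∞ | ∃ k : ℕ, (k : ℕ∞) = n ∧ ResDimLE R P k M} ≤ (k : ℕ∞) :=
        sInf_le ⟨k, rfl, hk'⟩
      rw [h] at this
      have : n ≤ k := by exact_mod_cast this
      omega
  · rintro ⟨h1, h2⟩
    apply le_antisymm
    · exact sInf_le ⟨n, rfl, h1⟩
    · apply le_sInf
      rintro _ ⟨k, rfl, hk⟩
      by_contra hc
      apply h2 k _ hk
      rw [not_le] at hc
      exact_mod_cast hc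

end P1
end CMProof

open Paper

namespace CMProof

section P2
variable {R : Type u} [CommRing R]

/-- Linear postcomposition on `Ext`. -/
noncomputable def post (X : ModuleCat.{u} R) {Y Z : ModuleCat.{u} R} {a b c : ℕ}
    (β : Abelian.Ext Y Z b) (h : a + b = c) : Abelian.Ext X Y a →ₗ[R] Abelian.Ext X Z c where
  toFun α := α.comp β h
  map_add' α α' := by simp
  map_smul' r α := by simp

/-- Linear precomposition on `Ext`. -/
noncomputable def pre {X Y : ModuleCat.{u} R} (Z : ModuleCat.{u} R) {a b c : ℕ}
    (α : Abelian.Ext X Y a) (h : a + b = c) : Abelian.Ext Y Z b →ₗ[R] Abelian.Ext X Z c where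
  toFun β := α.comp β h
  map_add' α α' := by simp
  map_smul' r α := by simp

@[simp] lemma post_apply (X : ModuleCat.{u} R) {Y Z : ModuleCat.{u} R} {a b c : ℕ}
    (β : Abelian.Ext Y Z b) (h : a + b = c) (α : Abelian.Ext X Y a) :
    post X β h α = α.comp β h := rfl

@[simp] lemma pre_apply {X Y : ModuleCat.{u} R} (Z : ModuleCat.{u} R) {a b c : ℕ}
    (α : Abelian.Ext X Y a) (h : a + b = c) (β : Abelian.Ext Y Z b) :
    pre Z α h β = α.comp β h := rfl

/-- Derived `x`-completeness, in elementary terms. -/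
def XC (x : R) (A : Type*) [AddCommGroup A] [Module R A] : Prop :=
  (∀ f : ℕ → A, (∀ i, f i = x • f (i + 1)) → ∀ i, f i = 0) ∧
  (∀ g : ℕ → A, ∃ g' : ℕ → A, ∀ i, g' i = g i + x • g' (i + 1))

lemma XC.of_exact {x : R} {A B C : Type*} [AddCommGroup A] [Module R A] [AddCommGroup B]
    [Module R B] [AddCommGroup C] [Module R C] (φ : A →ₗ[R] B) (ψ : B →ₗ[R] C)
    (hφψ : ∀ b, ψ b = 0 → ∃ a, φ a = b) (hψφ : ∀ a, ψ (φ a) = 0)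
    (hψ : Function.Surjective ψ) (hA : XC x A) (hB : XC x B) : XC x C := by
  refine ⟨fun f hf => ?_, fun g => ?_⟩
  · choose e he using fun i => hψ (f i)
    have h1 : ∀ i, ∃ a, φ a = e i - x • e (i+1) := by
      intro i
      apply hφψ
      rw [map_sub, map_smul, he, he, ← hf, sub_self]
    choose g hg using h1
    obtain ⟨g', hg'⟩ := hA.2 g
    have h2 := hB.1 (fun i => e i - φ (g' i)) (by
      intro i
      rw [hg' i, map_add, hg, map_smul, smul_sub]
      abel)
    intro i
    have h3 : e i = φ (g' i) := sub_eq_zero.1 (h2 i)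
    rw [← he, h3, hψφ]
  · choose e he using fun i => hψ (g i)
    obtain ⟨g', hg'⟩ := hB.2 e
    exact ⟨fun i => ψ (g' i), fun i => by beta_reduce; rw [hg' i, map_add, he, map_smul]⟩

lemma XC.of_equiv {x : R} {A B : Type*} [AddCommGroup A] [Module R A] [AddCommGroup B]
    [Module R B] (e : A ≃ₗ[R] B) (hA : XC x A) : XC x B := by
  refine XC.of_exact (0 : A →ₗ[R] A) e.toLinearMap (fun b hb => ⟨0, ?_⟩) (fun a => by simp)
    e.surjective hA hA
  exact ((e.map_eq_zero_iff).1 hb).symm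

lemma XC.of_subsingleton {x : R} {A : Type*} [AddCommGroup A] [Module R A] [Subsingleton A] :
    XC x A := ⟨fun _ _ _ => Subsingleton.elim _ _, fun g => ⟨g, fun _ => Subsingleton.elim _ _⟩⟩

lemma XC.subsingleton {x : R} {A : Type*} [AddCommGroup A] [Module R A] (hA : XC x A)
    (hx : ∀ a : A, ∃ b, a = x • b) : Subsingleton A := by
  choose s hs using hx
  refine subsingleton_of_forall_eq 0 fun a => ?_
  exact hA.1 (fun i => s^[i] a) (fun i => by
    rw [Function.iterate_succ_apply', ← hs]) 0

/-- every element killed by a power of `x`. -/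
def PTors (x : R) (H : Type*) [AddCommGroup H] [Module R H] : Prop :=
  ∀ h : H, ∃ k : ℕ, x ^ k • h = 0

lemma XC_hom {x : R} {H N : Type*} [AddCommGroup H] [Module R H] [AddCommGroup N] [Module R N]
    (hH : PTors x H) : XC x (H →ₗ[R] N) := by
  have hpow : ∀ (h : H) (k l : ℕ), x ^ k • h = 0 → k ≤ l → x ^ l • h = 0 := by
    intro h k l hk hkl
    obtain ⟨m, rfl⟩ := Nat.exists_eq_add_of_le hkl
    rw [pow_add, mul_comm, mul_smul, hk, smul_zero]
  refine ⟨fun f hf i => ?_, fun g => ?_⟩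
  · ext h
    have h1 : ∀ k, f i = x ^ k • f (i + k) := by
      intro k
      induction k with
      | zero => simp
      | succ k ih => rw [ih, hf (i+k), pow_succ, mul_smul, add_assoc]
    obtain ⟨k, hk⟩ := hH h
    rw [h1 k, LinearMap.smul_apply, ← map_smul, hk, map_zero, LinearMap.zero_apply]
  · let S : ℕ → H → N := fun i h => ∑ᶠ k, g (i + k) (x ^ k • h)
    have hS : ∀ (i : ℕ) (h : H) (K : ℕ), x ^ K • h = 0 →
        S i h = ∑ k ∈ Finset.range K, g (i+k) (x^k • h) := by
      intro i h K hK
      apply finsum_eq_sum_of_support_subset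
      intro k hk
      simp only [Function.mem_support] at hk
      simp only [Finset.coe_range, Set.mem_Iio]
      by_contra hc
      exact hk (by rw [hpow h K k hK (by omega), map_zero])
    refine ⟨fun i => { toFun := S i, map_add' := ?_, map_smul' := ?_ }, ?_⟩
    · intro h h'
      obtain ⟨k, hk⟩ := hH h
      obtain ⟨k', hk'⟩ := hH h'
      have e1 := hpow _ _ (max k k') hk (le_max_left _ _)
      have e2 := hpow _ _ (max k k') hk' (le_max_right _ _)
      rw [hS _ _ _ e1, hS _ _ _ e2, hS _ _ (max k k') (by rw [smul_add, e1, e2, add_zero]),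
        ← Finset.sum_add_distrib]
      simp only [smul_add, map_add]
    · intro r h
      obtain ⟨k, hk⟩ := hH h
      rw [hS _ _ _ hk, hS _ _ k (by rw [smul_comm, hk, smul_zero]), Finset.smul_sum]
      refine Finset.sum_congr rfl fun j _ => ?_
      rw [smul_comm, map_smul, RingHom.id_apply]
    · intro i
      ext h
      obtain ⟨k, hk⟩ := hH h
      change S i h = g i h + x • S (i+1) h
      rw [hS _ _ (k+1) (hpow _ _ _ hk (by omega)), hS _ _ _ hk, Finset.sum_range_succ',
        Finset.smul_sum, add_comm]
      congr 1
      · simp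
      · refine Finset.sum_congr rfl fun j _ => ?_
        rw [← map_smul, pow_succ', mul_smul, ← add_assoc, add_right_comm]

/-- swapping variables for maps into character modules -/
noncomputable def flipCh (A B : Type*) [AddCommGroup A] [Module R A] [AddCommGroup B] [Module R B] :
    (A →ₗ[R] CharacterModule B) →ₗ[R] (B →ₗ[R] CharacterModule A) where
  toFun f :=
    { toFun := fun b => AddMonoidHom.mk' (fun a => f a b) (by
        intro a a'
        rw [map_add]; rfl)
      map_add' := fun b b' => by
        ext a
        exact map_add (f a) b b'
      map_smul' := fun r b => by
        ext a
        change f a (r • b) = f (r • a) b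
        rw [LinearMap.map_smul]; rfl }
  map_add' f g := by ext b a; rfl
  map_smul' r f := by
    ext b a
    change f a (r • b) = f (r • a) b
    rw [LinearMap.map_smul]; rfl

noncomputable def flipChEquiv (A B : Type*) [AddCommGroup A] [Module R A] [AddCommGroup B]
    [Module R B] : (A →ₗ[R] CharacterModule B) ≃ₗ[R] (B →ₗ[R] CharacterModule A) :=
  LinearEquiv.ofLinearMap (flipCh A B) (flipCh B A) (by ext; rfl) (by ext; rfl)

lemma XC_hom_ch {x : R} {H Z : Type*} [AddCommGroup H] [Module R H] [AddCommGroup Z] [Module R Z]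
    (hH : PTors x H) : XC x (Z →ₗ[R] CharacterModule H) :=
  XC.of_equiv (flipChEquiv H Z) (XC_hom hH)

lemma XC_ext {x : R} {H : ModuleCat.{u} R} (hH : PTors x H) (n : ℕ) (N : ModuleCat.{u} R) :
    XC x (Abelian.Ext H N n) := by
  induction n generalizing N with
  | zero =>
    exact XC.of_equiv ((Abelian.Ext.linearEquiv₀ (R := R)).trans
      (ModuleCat.homLinearEquiv (S := R))).symm (XC_hom hH)
  | succ n ih =>
    obtain ⟨⟨I, hI, f, hf⟩⟩ := EnoughInjectives.presentation N
    have hS : (ShortComplex.mk f (Limits.cokernel.π f) (by simp)).ShortExact :=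
      { exact := ShortComplex.exact_of_g_is_cokernel _ (Limits.cokernelIsCokernel f) }
    have hI' : XC x (Abelian.Ext H I n) := ih I
    refine XC.of_exact (post H (Abelian.Ext.mk₀ (Limits.cokernel.π f)) (add_zero n))
      (post H hS.extClass (rfl : n + 1 = n + 1)) ?_ ?_ ?_ (ih _) (ih _)
    · intro b hb
      exact Abelian.Ext.covariant_sequence_exact₃ H hS b rfl hb
    · intro a
      simp [Abelian.Ext.comp_assoc_of_second_deg_zero, hS.comp_extClass]
    · intro c
      exact Abelian.Ext.covariant_sequence_exact₁ H hS c (Abelian.Ext.eq_zero_of_injective _) rfl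

lemma XC_ext_ch {x : R} {H : ModuleCat.{u} R} (hH : PTors x H) (n : ℕ) (N : ModuleCat.{u} R) :
    XC x (Abelian.Ext N (ch H) n) := by
  induction n generalizing N with
  | zero =>
    exact XC.of_equiv ((Abelian.Ext.linearEquiv₀ (R := R)).trans
      (ModuleCat.homLinearEquiv (S := R))).symm (XC_hom_ch hH)
  | succ n ih =>
    obtain ⟨⟨P, f⟩⟩ := EnoughProjectives.presentation N
    have hS : (ShortComplex.mk (Limits.kernel.ι f) f (by simp)).ShortExact :=
      { exact := ShortComplex.exact_of_f_is_kernel _ (Limits.kernelIsKernel f) }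
    refine XC.of_exact (pre (ch H) (Abelian.Ext.mk₀ (Limits.kernel.ι f)) (zero_add n))
      (pre (ch H) hS.extClass (add_comm 1 n)) ?_ ?_ ?_ (ih _) (ih _)
    · intro b hb
      exact Abelian.Ext.contravariant_sequence_exact₁ hS _ b (add_comm 1 n) hb
    · intro a
      exact hS.extClass_comp_assoc a (h := add_comm 1 n)
    · intro c
      exact Abelian.Ext.contravariant_sequence_exact₃ hS _ c
        (Abelian.Ext.eq_zero_of_projective _) (add_comm 1 n)

end P2
end CMProof

open Paper

namespace CMProof

section P3
variable {R : Type u} [CommRing R]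

lemma ext_surj_of_epi {H A B : ModuleCat.{u} R} (p : A ⟶ B) [Epi p] (n : ℕ)
    [HasProjectiveDimensionLT H (n + 1)] (α : Abelian.Ext H B n) :
    ∃ β : Abelian.Ext H A n, β.comp (Abelian.Ext.mk₀ p) (add_zero n) = α := by
  have hS : (ShortComplex.mk (Limits.kernel.ι p) p (by simp)).ShortExact :=
      { exact := ShortComplex.exact_of_f_is_kernel _ (Limits.kernelIsKernel p) }
  have : Subsingleton (Abelian.Ext H (Limits.kernel p) (n+1)) :=
    HasProjectiveDimensionLT.subsingleton H (n+1) (n+1) le_rfl _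
  exact Abelian.Ext.covariant_sequence_exact₃ H hS α rfl (Subsingleton.elim _ _)

lemma ext_surj_of_mono {J A B : ModuleCat.{u} R} (i : A ⟶ B) [Mono i] (n : ℕ)
    [HasInjectiveDimensionLT J (n + 1)] (α : Abelian.Ext A J n) :
    ∃ β : Abelian.Ext B J n, (Abelian.Ext.mk₀ i).comp β (zero_add n) = α := by
  have hS : (ShortComplex.mk i (Limits.cokernel.π i) (by simp)).ShortExact :=
      { exact := ShortComplex.exact_of_g_is_cokernel _ (Limits.cokernelIsCokernel i) }
  have : Subsingleton (Abelian.Ext (Limits.cokernel i) J (n+1)) :=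
    HasInjectiveDimensionLT.subsingleton J (n+1) (n+1) le_rfl _
  exact Abelian.Ext.contravariant_sequence_exact₁ hS J α (add_comm 1 n) (Subsingleton.elim _ _)

lemma ext_smul_surj {H V W : ModuleCat.{u} R} (x : R) (n : ℕ)
    [HasProjectiveDimensionLT H (n + 1)] (q : V ⟶ W) (hq : Function.Surjective q.hom)
    (hker : ∀ v, q.hom v = 0 → ∃ w, v = x • w) (hqx : ∀ v, q.hom (x • v) = 0)
    [Subsingleton (Abelian.Ext H W n)] (α : Abelian.Ext H V n) :
    ∃ β : Abelian.Ext H V n, α = x • β := by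
  have hS := LinearMap.shortExact_shortComplexKer hq
  obtain ⟨γ, hγ⟩ := Abelian.Ext.covariant_sequence_exact₂ H hS α (Subsingleton.elim _ _)
  let p : V ⟶ ModuleCat.of R (LinearMap.ker q.hom) := ModuleCat.ofHom
    (LinearMap.codRestrict _ (x • LinearMap.id) (fun v => hqx v))
  have hp : Epi p := by
    rw [ModuleCat.epi_iff_surjective]
    rintro ⟨v, hv⟩
    obtain ⟨w, rfl⟩ := hker v hv
    exact ⟨w, rfl⟩
  obtain ⟨β, hβ⟩ := ext_surj_of_epi p n γ
  refine ⟨β, ?_⟩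
  rw [← hγ, ← hβ, Abelian.Ext.smul_eq_comp_mk₀, Abelian.Ext.comp_assoc_of_third_deg_zero,
    Abelian.Ext.mk₀_comp_mk₀]
  rfl

lemma ext_smul_surj' {J V W : ModuleCat.{u} R} (x : R) (n : ℕ)
    [HasInjectiveDimensionLT J (n + 1)] (i : W ⟶ V) (hi : Function.Injective i.hom)
    (hker : ∀ v, x • v = 0 → ∃ w, i.hom w = v) (hix : ∀ w, x • i.hom w = 0)
    [Subsingleton (Abelian.Ext W J n)] (α : Abelian.Ext V J n) :
    ∃ β : Abelian.Ext V J n, α = x • β := by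
  let p : V →ₗ[R] LinearMap.range (x • LinearMap.id : V →ₗ[R] V) :=
    LinearMap.rangeRestrict _
  have hS : (ShortComplex.mk i (ModuleCat.ofHom p) (by
      ext w; exact hix w)).ShortExact := by
    refine ShortComplex.ShortExact.mk' ?_ ?_ ?_
    · rw [ShortComplex.ShortExact.moduleCat_exact_iff_function_exact]
      intro v
      constructor
      · intro hv
        exact hker v (congrArg Subtype.val hv)
      · rintro ⟨w, rfl⟩
        apply Subtype.ext; exact hix w
    · rwa [ModuleCat.mono_iff_injective]
    · rw [ModuleCat.epi_iff_surjective]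
      exact LinearMap.surjective_rangeRestrict _
  obtain ⟨γ, hγ⟩ := Abelian.Ext.contravariant_sequence_exact₂ hS J α (Subsingleton.elim _ _)
  let j : ModuleCat.of R (LinearMap.range (x • LinearMap.id : V →ₗ[R] V)) ⟶ V :=
    ModuleCat.ofHom (Submodule.subtype _)
  have hj : Mono j := by
    rw [ModuleCat.mono_iff_injective]
    exact Submodule.subtype_injective _
  obtain ⟨β, hβ⟩ := ext_surj_of_mono j n γ
  refine ⟨β, ?_⟩
  have : Abelian.Ext.mk₀ (ModuleCat.ofHom p ≫ j) = x • Abelian.Ext.mk₀ (𝟙 V) := by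
    rw [← Abelian.Ext.mk₀_smul]
    rfl
  rw [← hγ, ← hβ]
  erw [Abelian.Ext.mk₀_comp_mk₀_assoc]
  rw [this, Abelian.Ext.smul_comp, Abelian.Ext.mk₀_id_comp]

/-- killed by all elements of a list -/
def Killed (s : List R) (V : Type*) [AddCommGroup V] [Module R V] : Prop :=
  ∀ x ∈ s, ∀ v : V, x • v = 0

lemma ext_vanish (H : ModuleCat.{u} R) (n : ℕ) [HasProjectiveDimensionLT H (n + 1)] (s : List R)
    (hs : ∀ x ∈ s, PTors x H)
    (h : ∀ V : ModuleCat.{u} R, Killed s V → Subsingleton (Abelian.Ext H V n))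
    (N : ModuleCat.{u} R) : Subsingleton (Abelian.Ext H N n) := by
  induction s with
  | nil => exact h N (fun x hx => absurd hx List.not_mem_nil)
  | cons x s ih =>
    refine ih (fun y hy => hs y (by simp [hy])) fun V hV => ?_
    let W : ModuleCat.{u} R := ModuleCat.of R (V ⧸ LinearMap.range (x • LinearMap.id : V →ₗ[R] V))
    let q : V ⟶ W := ModuleCat.ofHom (Submodule.mkQ _)
    have hqx : ∀ v, q.hom (x • v) = 0 := fun v =>
      (Submodule.Quotient.mk_eq_zero _).2 ⟨v, rfl⟩
    have hq : Function.Surjective q.hom := Submodule.mkQ_surjective _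
    have hW : Subsingleton (Abelian.Ext H W n) := by
      apply h
      intro y hy w
      obtain ⟨v, rfl⟩ := hq w
      rw [← map_smul]
      rcases List.mem_cons.1 hy with rfl | hy
      · exact hqx v
      · rw [hV y hy v, map_zero]
    refine (XC_ext (hs x (by simp)) n V).subsingleton (fun α => ?_)
    refine ext_smul_surj x n q hq (fun v hv => ?_) hqx α
    obtain ⟨w, hw⟩ := (Submodule.Quotient.mk_eq_zero _).1 hv
    exact ⟨w, hw.symm⟩

lemma ext_vanish' (H : ModuleCat.{u} R) (n : ℕ) [HasInjectiveDimensionLT (ch H) (n + 1)]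
    (s : List R) (hs : ∀ x ∈ s, PTors x H)
    (h : ∀ V : ModuleCat.{u} R, Killed s V → Subsingleton (Abelian.Ext V (ch H) n))
    (N : ModuleCat.{u} R) : Subsingleton (Abelian.Ext N (ch H) n) := by
  induction s with
  | nil => exact h N (fun x hx => absurd hx List.not_mem_nil)
  | cons x s ih =>
    refine ih (fun y hy => hs y (by simp [hy])) fun V hV => ?_
    let W : ModuleCat.{u} R := ModuleCat.of R (LinearMap.ker (x • LinearMap.id : V →ₗ[R] V))
    let q : W ⟶ V := ModuleCat.ofHom (Submodule.subtype _)
    have hq : Function.Injective q.hom := Submodule.subtype_injective _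
    have hqx : ∀ w, x • q.hom w = 0 := fun w => w.2
    have hW : Subsingleton (Abelian.Ext W (ch H) n) := by
      apply h
      intro y hy w
      apply hq
      rw [map_smul, map_zero]
      rcases List.mem_cons.1 hy with rfl | hy
      · exact hqx w
      · rw [hV y hy]
    refine (XC_ext_ch (hs x (by simp)) n V).subsingleton (fun α => ?_)
    exact ext_smul_surj' x n q hq (fun v hv => ⟨⟨v, hv⟩, rfl⟩) hqx α

end P3
end CMProof

open Paper

namespace CMProof

section P4
open scoped Pointwise
variable {R : Type u} [CommRing R]

lemma regSeq_or_socle [IsNoetherianRing R] [IsLocalRing R] (n : ℕ) :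
    (∃ rs : List R, rs.length = n ∧ (∀ x ∈ rs, x ∈ maximalIdeal R) ∧
      RingTheory.Sequence.IsWeaklyRegular R rs) ∨
    (∃ rs : List R, rs.length < n ∧ (∀ x ∈ rs, x ∈ maximalIdeal R) ∧
      RingTheory.Sequence.IsWeaklyRegular R rs ∧
      ∃ f : (R ⧸ maximalIdeal R) →ₗ[R] (R ⧸ (Ideal.ofList rs • ⊤ : Submodule R R)), f ≠ 0) := by
  induction n with
  | zero => exact Or.inl ⟨[], rfl, by simp, RingTheory.Sequence.IsWeaklyRegular.nil R R⟩
  | succ n ih =>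
    rcases ih with ⟨rs, hl, hm, hr⟩ | ⟨rs, hl, h⟩
    · by_cases hs : Subsingleton
          ((R ⧸ maximalIdeal R) →ₗ[R] (R ⧸ (Ideal.ofList rs • ⊤ : Submodule R R)))
      · obtain ⟨r, hr1, hr2⟩ := IsSMulRegular.subsingleton_linearMap_iff.1 hs
        rw [Ideal.annihilator_quotient] at hr1
        refine Or.inl ⟨rs ++ [r], by simp [hl], ?_, ?_⟩
        · intro x hx
          rcases List.mem_append.1 hx with h | h
          · exact hm x h
          · rw [List.mem_singleton.1 h]; exact hr1
        · rw [RingTheory.Sequence.isWeaklyRegular_append_iff]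
          exact ⟨hr, (RingTheory.Sequence.isWeaklyRegular_singleton_iff _ _).2 hr2⟩
      · refine Or.inr ⟨rs, by omega, hm, hr, ?_⟩
        by_contra hc
        push Not at hc
        exact hs (subsingleton_of_forall_eq 0 hc)
    · exact Or.inr ⟨rs, by omega, h⟩

lemma pd_finsupp (I : Type u) (rs : List R) (M : Type u) [AddCommGroup M] [Module R M] (a : ℕ)
    (hM : HasProjectiveDimensionLT (ModuleCat.of R (I →₀ M)) (a + 1))
    (hr : RingTheory.Sequence.IsWeaklyRegular M rs) :
    HasProjectiveDimensionLT
      (ModuleCat.of R (I →₀ (M ⧸ (Ideal.ofList rs • ⊤ : Submodule R M)))) (a + rs.length + 1) := by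
  induction rs generalizing M a with
  | nil =>
    have e : M ≃ₗ[R] (M ⧸ (Ideal.ofList ([] : List R) • ⊤ : Submodule R M)) :=
      (Submodule.quotEquivOfEqBot _ (by simp)).symm
    exact hasProjectiveDimensionLT_of_iso (Finsupp.mapRange.linearEquiv e).toModuleIso _
  | cons x rs ih =>
    rw [RingTheory.Sequence.isWeaklyRegular_cons_iff] at hr
    have e := Submodule.quotOfListConsSMulTopEquivQuotSMulTopInner M x rs
    have h1 : HasProjectiveDimensionLT (ModuleCat.of R (I →₀ QuotSMulTop x M)) (a + 1 + 1) := by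
      let S : ShortComplex (ModuleCat.{u} R) := ShortComplex.mk
        (ModuleCat.ofHom (x • LinearMap.id : (I →₀ M) →ₗ[R] (I →₀ M)))
        (ModuleCat.ofHom (Finsupp.mapRange.linearMap (Submodule.mkQ (x • (⊤ : Submodule R M))))) (by
          apply ModuleCat.hom_ext; apply LinearMap.ext; intro m
          refine Finsupp.ext (M := QuotSMulTop x M) fun i => ?_
          exact (Submodule.Quotient.mk_eq_zero _).2
            (Submodule.smul_mem_pointwise_smul (m i) x ⊤ trivial))
      have hS : S.ShortExact := by
        refine ShortComplex.ShortExact.mk' ?_ ?_ ?_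
        · rw [ShortComplex.ShortExact.moduleCat_exact_iff_function_exact]
          intro (v : I →₀ M)
          constructor
          · intro (hv : Finsupp.mapRange.linearMap (Submodule.mkQ (x • (⊤ : Submodule R M))) v = 0)
            have h2 : ∀ i, ∃ m, x • m = v i := by
              intro i
              have h3 := DFunLike.congr_fun hv i
              simp only [Finsupp.mapRange.linearMap_apply, Finsupp.mapRange_apply,
                Finsupp.coe_zero, Pi.zero_apply, Submodule.mkQ_apply,
                Submodule.Quotient.mk_eq_zero] at h3
              obtain ⟨m, -, hm⟩ := (Submodule.mem_smul_pointwise_iff_exists _ _ _).1 h3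
              exact ⟨m, hm⟩
            choose g hg using h2
            refine ⟨(Finsupp.onFinset v.support g (fun i hi => ?_) : I →₀ M), ?_⟩
            · rw [Finsupp.mem_support_iff]
              intro h0
              apply hi
              apply hr.1
              change x • g i = x • 0
              rw [hg, h0, smul_zero]
            · apply Finsupp.ext (M := M)
              exact hg
          · rintro ⟨w, rfl⟩
            exact congrArg (fun g => g.hom w) S.zero
        · rw [ModuleCat.mono_iff_injective]
          intro v w hvw
          apply Finsupp.ext (M := M)
          intro i
          exact hr.1 (DFunLike.congr_fun (F := I →₀ M) hvw i)
        · rw [ModuleCat.epi_iff_surjective]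
          exact Finsupp.mapRange_surjective _ (map_zero _) (Submodule.mkQ_surjective _)
      exact hS.hasProjectiveDimensionLT_X₃ (a + 1) hM (hasProjectiveDimensionLT_of_ge _ (a+1) _ (by omega))
    have h2 := ih _ _ h1 hr.2
    have h3 := hasProjectiveDimensionLT_of_iso (Finsupp.mapRange.linearEquiv (α := I) e.symm).toModuleIso
      (a + 1 + rs.length + 1)
    have : a + 1 + rs.length + 1 = a + (x :: rs).length + 1 := by simp; omega
    rw [← this]
    exact h3

variable [IsLocalRing R]

lemma embed_killed (V : ModuleCat.{u} R) (hV : ∀ x ∈ maximalIdeal R, ∀ v : V, x • v = 0)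
    (Q : Type u) [AddCommGroup Q] [Module R Q] (f : (R ⧸ maximalIdeal R) →ₗ[R] Q) (hf : f ≠ 0) :
    ∃ (I : Type u) (g : V →ₗ[R] (I →₀ Q)), Function.Injective g := by
  let _ : Field (R ⧸ maximalIdeal R) := Ideal.Quotient.field _
  let _ : Module (R ⧸ maximalIdeal R) V := Module.IsTorsionBySet.module
    (M := V) (I := maximalIdeal R) (fun v a => hV a a.2 v)
  have : IsScalarTower R (R ⧸ maximalIdeal R) V := Module.IsTorsionBySet.isScalarTower
    (M := V) (I := maximalIdeal R) (fun v a => hV a a.2 v)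
  have hinj : Function.Injective f := by
    rw [← LinearMap.ker_eq_bot, Submodule.eq_bot_iff]
    intro y hy
    by_contra hy0
    apply hf
    ext
    obtain ⟨r, hr⟩ := Ideal.Quotient.mk_surjective (y⁻¹)
    have h1 : r • y = 1 := by
      rw [Algebra.smul_def]
      change (Ideal.Quotient.mk _ r) * y = 1
      rw [hr, inv_mul_cancel₀ hy0]
    have h2 : f 1 = 0 := by
      rw [← h1, map_smul, LinearMap.mem_ker.1 hy, smul_zero]
    exact h2
  obtain ⟨I, ⟨b⟩⟩ := Module.Basis.exists_basis (R ⧸ maximalIdeal R) V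
  refine ⟨I, (Finsupp.mapRange.linearMap f) ∘ₗ (b.repr.toLinearMap.restrictScalars R), ?_⟩
  rw [LinearMap.coe_comp]
  exact (Finsupp.mapRange_injective _ (map_zero _) hinj).comp b.repr.injective

/-- evaluation into the double character module -/
noncomputable def evCh (V : ModuleCat.{u} R) : V →ₗ[R] CharacterModule (CharacterModule V) :=
  flipCh _ _ LinearMap.id

lemma evCh_retract (V : ModuleCat.{u} R) (hV : ∀ x ∈ maximalIdeal R, ∀ v : V, x • v = 0) :
    ∃ r : CharacterModule (CharacterModule V) →ₗ[R] V, r ∘ₗ evCh V = LinearMap.id := by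
  let _ : Field (R ⧸ maximalIdeal R) := Ideal.Quotient.field _
  let _ : Module (R ⧸ maximalIdeal R) V := Module.IsTorsionBySet.module
    (M := V) (I := maximalIdeal R) (fun v a => hV a a.2 v)
  have : IsScalarTower R (R ⧸ maximalIdeal R) V := Module.IsTorsionBySet.isScalarTower
    (M := V) (I := maximalIdeal R) (fun v a => hV a a.2 v)
  have hW : ∀ x ∈ maximalIdeal R, ∀ v : CharacterModule (CharacterModule V), x • v = 0 := by
    intro x hx v
    ext φ
    have : x • φ = 0 := by
      ext v
      change φ (x • v) = 0
      rw [hV x hx, map_zero]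
    change v (x • φ) = 0
    rw [this, map_zero]
  let _ : Module (R ⧸ maximalIdeal R) (CharacterModule (CharacterModule V)) :=
    Module.IsTorsionBySet.module (I := maximalIdeal R) (fun v a => hW a a.2 v)
  have : IsScalarTower R (R ⧸ maximalIdeal R) (CharacterModule (CharacterModule V)) :=
    Module.IsTorsionBySet.isScalarTower (I := maximalIdeal R) (fun v a => hW a a.2 v)
  let e : V →ₗ[R ⧸ maximalIdeal R] CharacterModule (CharacterModule V) :=
    { evCh V with
      map_smul' := by
        intro c v
        obtain ⟨r, rfl⟩ := Ideal.Quotient.mk_surjective c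
        exact (evCh V).map_smul r v }
  have he : LinearMap.ker e = ⊥ := by
    rw [Submodule.eq_bot_iff]
    intro v hv
    apply CharacterModule.eq_zero_of_character_apply
    intro c
    exact DFunLike.congr_fun (LinearMap.mem_ker.1 hv) c
  obtain ⟨r, hr⟩ := LinearMap.exists_leftInverse_of_injective e he
  refine ⟨r.restrictScalars R, ?_⟩
  ext v
  exact LinearMap.congr_fun hr v

variable [IsNoetherianRing R]

lemma exists_regSeq_of_injDim (H : ModuleCat.{u} R) (hH : ∀ x ∈ maximalIdeal R, PTors x H) (n : ℕ)
    (h1 : HasInjectiveDimensionLT (ch H) (n + 1)) (h2 : ¬ HasInjectiveDimensionLT (ch H) n) :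
    ∃ rs : List R, rs.length = n ∧ (∀ x ∈ rs, x ∈ maximalIdeal R) ∧
      RingTheory.Sequence.IsWeaklyRegular R rs := by
  refine (regSeq_or_socle n).resolve_right ?_
  rintro ⟨rs, hl, hm, hr, f, hf⟩
  apply h2
  apply hasInjectiveDimensionLT_of_enoughProjectives
  obtain ⟨s, hs⟩ := (maximalIdeal R).fg_of_isNoetherianRing
  refine ext_vanish' H n s.toList (fun x hx => hH x ?_) (fun V hV => ?_)
  · rw [← hs]; exact Ideal.subset_span (by simpa using hx)
  have hV' : ∀ x ∈ maximalIdeal R, ∀ v : V, x • v = 0 := by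
    intro x hx v
    rw [← hs] at hx
    have : Ideal.span (s : Set R) ≤ Module.annihilator R V := by
      rw [Ideal.span_le]
      intro y hy
      exact Module.mem_annihilator.2 (hV y (by simpa using hy))
    exact Module.mem_annihilator.1 (this hx) v
  obtain ⟨I, g, hg⟩ := embed_killed V hV' _ f hf
  have hpd := pd_finsupp I rs R 0 (by
    have : Projective (ModuleCat.of R (I →₀ R)) :=
      (IsProjective.iff_projective _).1 inferInstance
    infer_instance) hr
  have : Subsingleton (Abelian.Ext (ModuleCat.of R
      (I →₀ (R ⧸ (Ideal.ofList rs • ⊤ : Submodule R R)))) (ch H) n) :=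
    HasProjectiveDimensionLT.subsingleton _ (0 + rs.length + 1) _ (by omega) _
  have : Mono (ModuleCat.ofHom g) := (ModuleCat.mono_iff_injective _).2 hg
  refine subsingleton_of_forall_eq 0 fun α => ?_
  obtain ⟨β, rfl⟩ := ext_surj_of_mono (ModuleCat.ofHom g) n α
  rw [Subsingleton.elim β 0, Abelian.Ext.comp_zero]

lemma exists_regSeq_of_projDim (H : ModuleCat.{u} R) (hH : ∀ x ∈ maximalIdeal R, PTors x H) (n : ℕ)
    (h1 : HasProjectiveDimensionLT H (n + 1)) (h2 : ¬ HasProjectiveDimensionLT H n) :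
    ∃ rs : List R, rs.length = n ∧ (∀ x ∈ rs, x ∈ maximalIdeal R) ∧
      RingTheory.Sequence.IsWeaklyRegular R rs := by
  refine (regSeq_or_socle n).resolve_right ?_
  rintro ⟨rs, hl, hm, hr, f, hf⟩
  apply h2
  apply hasProjectiveDimensionLT_of_enoughInjectives
  obtain ⟨s, hs⟩ := (maximalIdeal R).fg_of_isNoetherianRing
  refine ext_vanish H n s.toList (fun x hx => hH x ?_) (fun V hV => ?_)
  · rw [← hs]; exact Ideal.subset_span (by simpa using hx)
  have hV' : ∀ x ∈ maximalIdeal R, ∀ v : V, x • v = 0 := by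
    intro x hx v
    rw [← hs] at hx
    have : Ideal.span (s : Set R) ≤ Module.annihilator R V := by
      rw [Ideal.span_le]
      intro y hy
      exact Module.mem_annihilator.2 (hV y (by simpa using hy))
    exact Module.mem_annihilator.1 (this hx) v
  have hVc : ∀ x ∈ maximalIdeal R, ∀ v : ch V, x • v = 0 := by
    intro x hx (φ : CharacterModule V)
    refine CharacterModule.ext (A := V) fun v => ?_
    change φ (x • v) = 0
    rw [hV' x hx, map_zero]
  obtain ⟨I, g, hg⟩ := embed_killed (ch V) hVc _ f hf
  have hpd := pd_finsupp I rs R 0 (by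
    have : Projective (ModuleCat.of R (I →₀ R)) :=
      (IsProjective.iff_projective _).1 inferInstance
    infer_instance) hr
  have hid := injDimLT_ch _ _ hpd
  have : Subsingleton (Abelian.Ext H (ch (ModuleCat.of R
      (I →₀ (R ⧸ (Ideal.ofList rs • ⊤ : Submodule R R))))) n) :=
    HasInjectiveDimensionLT.subsingleton _ (0 + rs.length + 1) _ (by omega) _
  obtain ⟨r, hr⟩ := evCh_retract V hV'
  have hdual : Function.Surjective (CharacterModule.dual g) :=
    CharacterModule.dual_surjective_of_injective _ hg
  have hrs : Function.Surjective r := fun v => ⟨evCh V v, LinearMap.congr_fun hr v⟩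
  let p : ch (ModuleCat.of R (I →₀ (R ⧸ (Ideal.ofList rs • ⊤ : Submodule R R)))) ⟶ V :=
    ModuleCat.ofHom (r ∘ₗ CharacterModule.dual g)
  have : Epi p := by
    rw [ModuleCat.epi_iff_surjective]
    exact hrs.comp hdual
  refine subsingleton_of_forall_eq 0 fun α => ?_
  obtain ⟨β, rfl⟩ := ext_surj_of_epi p n α
  rw [Subsingleton.elim β 0, Abelian.Ext.zero_comp]

end P4
end CMProof

open Paper

namespace CMProof
section P5
variable {R : Type u} [CommRing R]

section opcx
variable (K : ChainComplex (ModuleCat.{u} R)ᵒᵖ ℕ) (n : ℕ)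

lemma op_p_inj : Function.Injective (K.pOpcycles n).unop.hom := by
  have : Mono (K.pOpcycles n).unop := inferInstance
  exact (ModuleCat.mono_iff_injective _).1 this

lemma op_p_exact :
    Function.Exact (K.pOpcycles n).unop.hom (K.d (n+1) n).unop.hom := by
  have h : (ShortComplex.mk _ _ (K.d_pOpcycles (n+1) n)).Exact :=
    ShortComplex.exact_of_g_is_cokernel _ (K.opcyclesIsCokernel (n+1) n (by simp))
  exact (ShortComplex.ShortExact.moduleCat_exact_iff_function_exact _).1 h.unop

lemma op_ι_surj : Function.Surjective (K.homologyι n).unop.hom := by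
  have : Epi (K.homologyι n).unop := inferInstance
  exact (ModuleCat.epi_iff_surjective _).1 this

lemma op_ι_exact (j : ℕ) (hj : (ComplexShape.down ℕ).next n = j) :
    Function.Exact (K.fromOpcycles n j).unop.hom (K.homologyι n).unop.hom := by
  have h : (ShortComplex.mk _ _ (K.homologyι_comp_fromOpcycles n j)).Exact :=
    ShortComplex.exact_of_f_is_kernel _ (K.homologyIsKernel n j hj)
  exact (ShortComplex.ShortExact.moduleCat_exact_iff_function_exact _).1 h.unop

end opcx

/-- The old `Ext`. -/
noncomputable abbrev oExt (X Y : ModuleCat.{u} R) (n : ℕ) : ModuleCat.{u} R :=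
  ((Ext R (ModuleCat.{u} R) n).obj (Opposite.op X)).obj Y

/-- The complex computing the old `Ext`. -/
noncomputable abbrev homCx {X : ModuleCat.{u} R} (P : ProjectiveResolution X) (Y : ModuleCat.{u} R) :
    ChainComplex (ModuleCat.{u} R)ᵒᵖ ℕ :=
  (((linearYoneda R (ModuleCat.{u} R)).obj Y).rightOp.mapHomologicalComplex _).obj P.complex

/-- cocycles -/
noncomputable abbrev Zc {X : ModuleCat.{u} R} (P : ProjectiveResolution X) (Y : ModuleCat.{u} R) (n : ℕ) :
    ModuleCat.{u} R := ((homCx P Y).opcycles n).unop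

/-- underlying homomorphism of a cocycle -/
noncomputable def Zp {X : ModuleCat.{u} R} (P : ProjectiveResolution X) (Y : ModuleCat.{u} R) (n : ℕ) :
    Zc P Y n →ₗ[R] (P.complex.X n ⟶ Y) := ((homCx P Y).pOpcycles n).unop.hom

lemma Zp_inj {X : ModuleCat.{u} R} (P : ProjectiveResolution X) (Y : ModuleCat.{u} R) (n : ℕ) :
    Function.Injective (Zp P Y n) := op_p_inj (homCx P Y) n

lemma Zp_d {X : ModuleCat.{u} R} (P : ProjectiveResolution X) (Y : ModuleCat.{u} R) (n : ℕ)
    (z : Zc P Y n) : P.complex.d (n+1) n ≫ Zp P Y n z = 0 :=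
  (op_p_exact (homCx P Y) n _).2 ⟨z, rfl⟩

lemma Zp_exists {X : ModuleCat.{u} R} (P : ProjectiveResolution X) (Y : ModuleCat.{u} R) (n : ℕ)
    (f : P.complex.X n ⟶ Y) (hf : P.complex.d (n+1) n ≫ f = 0) : ∃ z, Zp P Y n z = f :=
  (op_p_exact (homCx P Y) n f).1 hf

/-- The old Ext in the opposite category -/
noncomputable abbrev lD (X Y : ModuleCat.{u} R) (n : ℕ) : (ModuleCat.{u} R)ᵒᵖ :=
  (((linearYoneda R (ModuleCat.{u} R)).obj Y).rightOp.leftDerived n).obj X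

/-- Computation of the derived functor -/
noncomputable def ldIso {X : ModuleCat.{u} R} (P : ProjectiveResolution X) (Y : ModuleCat.{u} R) (n : ℕ) :
    lD X Y n ≅ (homCx P Y).homology n :=
  P.isoLeftDerivedObj ((linearYoneda R (ModuleCat.{u} R)).obj Y).rightOp n

lemma ldIso_nat {X X' : ModuleCat.{u} R} {f : X ⟶ X'} {P : ProjectiveResolution X}
    {Q : ProjectiveResolution X'} (φ : ProjectiveResolution.Hom P Q f) (Y : ModuleCat.{u} R) (n : ℕ) :
    (((linearYoneda R (ModuleCat.{u} R)).obj Y).rightOp.leftDerived n).map f ≫ (ldIso Q Y n).hom =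
      (ldIso P Y n).hom ≫ HomologicalComplex.homologyMap
        ((((linearYoneda R (ModuleCat.{u} R)).obj Y).rightOp.mapHomologicalComplex _).map φ.hom :
          homCx P Y ⟶ homCx Q Y) n :=
  ProjectiveResolution.isoLeftDerivedObj_hom_naturality f P Q φ.hom
      φ.hom_f_zero_comp_π_f_zero _ n

/-- class in the old Ext -/
noncomputable def Zκ {X : ModuleCat.{u} R} (P : ProjectiveResolution X) (Y : ModuleCat.{u} R) (n : ℕ) :
    Zc P Y n →ₗ[R] oExt X Y n :=
  ((ldIso P Y n).hom ≫ (homCx P Y).homologyι n).unop.hom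

lemma Zκ_surj {X : ModuleCat.{u} R} (P : ProjectiveResolution X) (Y : ModuleCat.{u} R) (n : ℕ) :
    Function.Surjective (Zκ P Y n) := by
  have : Epi ((ldIso P Y n).hom ≫ (homCx P Y).homologyι n).unop := inferInstance
  exact (ModuleCat.epi_iff_surjective _).1 this

lemma Zκ_eq_zero {X : ModuleCat.{u} R} (P : ProjectiveResolution X) (Y : ModuleCat.{u} R) (n j : ℕ)
    (hj : (ComplexShape.down ℕ).next n = j) (z : Zc P Y n) :
    Zκ P Y n z = 0 ↔ ∃ g : P.complex.X j ⟶ Y, P.complex.d n j ≫ g = Zp P Y n z := by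
  have e1 : Zκ P Y n z = 0 ↔ ((homCx P Y).homologyι n).unop.hom z = 0 := by
    have hi : Function.Injective (ldIso P Y n).hom.unop.hom :=
      (ModuleCat.mono_iff_injective _).1 inferInstance
    constructor
    · intro h
      exact hi (h.trans (map_zero _).symm)
    · intro h
      have : Zκ P Y n z = (ldIso P Y n).hom.unop.hom
          (((homCx P Y).homologyι n).unop.hom z) := rfl
      rw [this, h, map_zero]; rfl
  rw [e1, op_ι_exact (homCx P Y) n j hj z]
  have e2 : ∀ g : P.complex.X j ⟶ Y,
      Zp P Y n (((homCx P Y).fromOpcycles n j).unop.hom g) = P.complex.d n j ≫ g := by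
    intro g
    have := congrArg (fun f => f.unop.hom g) ((homCx P Y).p_fromOpcycles n j)
    exact this
  constructor
  · rintro ⟨g, hg⟩
    exact ⟨g, by rw [← hg]; exact (e2 g).symm⟩
  · rintro ⟨g, hg⟩
    exact ⟨g, Zp_inj P Y n ((e2 g).trans hg)⟩

/-- class in the new Ext -/
noncomputable def Zl {X : ModuleCat.{u} R} (P : ProjectiveResolution X) (Y : ModuleCat.{u} R) (n : ℕ) :
    Zc P Y n →ₗ[R] Abelian.Ext X Y n where
  toFun z := P.extMk (Zp P Y n z) (n+1) rfl (Zp_d P Y n z)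
  map_add' a b := by
    rw [P.add_extMk]
    congr 1
    exact map_add _ _ _
  map_smul' r a := by
    rw [RingHom.id_apply, Abelian.Ext.smul_eq_comp_mk₀, P.extMk_comp_mk₀]
    congr 1
    rw [map_smul, Linear.comp_smul, Category.comp_id]

lemma Zl_surj {X : ModuleCat.{u} R} (P : ProjectiveResolution X) (Y : ModuleCat.{u} R) (n : ℕ) :
    Function.Surjective (Zl P Y n) := by
  intro a
  obtain ⟨f, hf, rfl⟩ := P.extMk_surjective a (n+1) rfl
  obtain ⟨z, rfl⟩ := Zp_exists P Y n f hf
  exact ⟨z, rfl⟩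

lemma Zl_eq_zero {X : ModuleCat.{u} R} (P : ProjectiveResolution X) (Y : ModuleCat.{u} R) (n j : ℕ)
    (hj : (ComplexShape.down ℕ).next n = j) (z : Zc P Y n) :
    Zl P Y n z = 0 ↔ ∃ g : P.complex.X j ⟶ Y, P.complex.d n j ≫ g = Zp P Y n z := by
  cases n with
  | succ p =>
    obtain rfl : p = j := by
      rw [← hj]; symm; exact ComplexShape.next_eq' _ (by simp)
    exact P.extMk_eq_zero_iff _ _ rfl (Zp_d P Y _ z) p rfl
  | zero =>
    have hd : P.complex.d 0 j = 0 := P.complex.shape _ _ (by simp)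
    constructor
    · intro h
      refine ⟨0, ?_⟩
      rw [Limits.comp_zero]
      change P.extMk (Zp P Y 0 z) 1 rfl (Zp_d P Y 0 z) = 0 at h
      rw [← P.extEquivCohomologyClass.apply_eq_iff_eq,
        P.extEquivCohomologyClass_extMk, P.extEquivCohomologyClass_zero,
        CochainComplex.HomComplex.CohomologyClass.mk_eq_zero_iff,
        CochainComplex.HomComplex.Cocycle.toSingleMk_mem_coboundaries_iff _ _ _ _ _ 1 (by lia)] at h
      obtain ⟨g, hg⟩ := h
      have h0 : P.cochainComplex.d (-((0:ℕ):ℤ)) 1 = 0 :=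
        (P.cochainComplex.isZero_of_isStrictlyLE 0 1 (by lia)).eq_of_tgt _ _
      rw [h0, Limits.zero_comp] at hg
      rw [← cancel_epi (P.cochainComplexXIso (-((0:ℕ):ℤ)) 0 rfl).hom, ← hg, Limits.comp_zero]
    · rintro ⟨g, hg⟩
      have hz : Zp P Y 0 z = 0 := by rw [← hg, hd, Limits.zero_comp]
      have : z = 0 := Zp_inj P Y 0 (hz.trans (map_zero _).symm)
      rw [this, map_zero]

lemma ker_Zκ {X : ModuleCat.{u} R} (P : ProjectiveResolution X) (Y : ModuleCat.{u} R) (n : ℕ) :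
    LinearMap.ker (Zκ P Y n) = LinearMap.ker (Zl P Y n) := by
  ext z
  rw [LinearMap.mem_ker, LinearMap.mem_ker, Zκ_eq_zero P Y n _ rfl, Zl_eq_zero P Y n _ rfl]

/-- The comparison between the old and the new Ext. -/
noncomputable def extCmp (X Y : ModuleCat.{u} R) (n : ℕ) : oExt X Y n ≃ₗ[R] Abelian.Ext X Y n :=
  ((Zκ (projectiveResolution X) Y n).quotKerEquivOfSurjective (Zκ_surj _ _ _)).symm.trans
    ((Submodule.quotEquivOfEq _ _ (ker_Zκ _ Y n)).trans
      ((Zl (projectiveResolution X) Y n).quotKerEquivOfSurjective (Zl_surj _ _ _)))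

lemma extCmp_Zκ (X Y : ModuleCat.{u} R) (n : ℕ) (z : Zc (projectiveResolution X) Y n) :
    extCmp X Y n (Zκ (projectiveResolution X) Y n z) = Zl (projectiveResolution X) Y n z := by
  have : Zκ (projectiveResolution X) Y n z =
    ((Zκ (projectiveResolution X) Y n).quotKerEquivOfSurjective (Zκ_surj _ _ _))
      (Submodule.Quotient.mk z) := rfl
  rw [extCmp, LinearEquiv.trans_apply, this, LinearEquiv.symm_apply_apply]
  rfl

/-- The map on old Ext. -/
noncomputable abbrev oMap {X X' : ModuleCat.{u} R} (f : X ⟶ X') (Y : ModuleCat.{u} R) (n : ℕ) :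
    oExt X' Y n ⟶ oExt X Y n := ((Ext R (ModuleCat.{u} R) n).map f.op).app Y

lemma extCmp_nat {X X' : ModuleCat.{u} R} (f : X ⟶ X') (Y : ModuleCat.{u} R) (n : ℕ)
    (a : oExt X' Y n) :
    extCmp X Y n ((oMap f Y n).hom a) =
      (Abelian.Ext.mk₀ f).comp (extCmp X' Y n a) (zero_add n) := by
  obtain ⟨z, rfl⟩ := Zκ_surj (projectiveResolution X') Y n a
  rw [extCmp_Zκ]
  let P := projectiveResolution X
  let Q := projectiveResolution X'
  let φ : ProjectiveResolution.Hom P Q f :=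
    { hom := ProjectiveResolution.lift f P Q
      hom_f_zero_comp_π_f_zero := ProjectiveResolution.lift_commutes_zero f P Q }
  let F := ((linearYoneda R (ModuleCat.{u} R)).obj Y).rightOp
  let ψ : homCx P Y ⟶ homCx Q Y := (F.mapHomologicalComplex _).map φ.hom
  let z' : Zc P Y n := (HomologicalComplex.opcyclesMap ψ n).unop.hom z
  have h1 : (oMap f Y n).hom (Zκ Q Y n z) = Zκ P Y n z' := by
    have e2 : (F.leftDerived n).map f ≫ (ldIso Q Y n).hom ≫ (homCx Q Y).homologyι n =
      ((ldIso P Y n).hom ≫ (homCx P Y).homologyι n) ≫ HomologicalComplex.opcyclesMap ψ n := by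
      rw [← Category.assoc, ldIso_nat φ Y n, Category.assoc, Category.assoc,
        ← HomologicalComplex.homologyι_naturality]
    exact congrArg (fun f => f.unop.hom z) e2
  have h2 : Zp P Y n z' = φ.hom.f n ≫ Zp Q Y n z := by
    exact congrArg (fun f => f.unop.hom z) (HomologicalComplex.p_opcyclesMap ψ n)
  refine (congrArg (extCmp X Y n) h1).trans ?_
  refine (extCmp_Zκ X Y n z').trans ?_
  change P.extMk (Zp P Y n z') (n+1) rfl (Zp_d P Y n z') = _
  refine Eq.trans ?_ (ProjectiveResolution.mk₀_comp_extMk (Zp Q Y n z) (n+1) rfl (Zp_d Q Y n z) φ).symm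
  congr 1

end P5
end CMProof

open Paper

namespace CMProof
section P6
variable {R : Type u} [CommRing R]

/-- `R ⧸ J ^ n` as an object. -/
noncomputable abbrev Rq (J : Ideal R) (n : ℕ) : ModuleCat.{u} R := ModuleCat.of R (R ⧸ J ^ n)

/-- The projection. -/
noncomputable abbrev Rpr (J : Ideal R) {n m : ℕ} (h : n ≤ m) : Rq J m ⟶ Rq J n :=
  ModuleCat.ofHom (Submodule.mapQ _ _ LinearMap.id (Ideal.pow_le_pow_right h))

/-- The cocone defining local cohomology, evaluated. -/
noncomputable def lcCocone (J : Ideal R) (d : ℕ) (M : ModuleCat.{u} R) :=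
  ((evaluation (ModuleCat.{u} R) (ModuleCat.{u} R)).obj M).mapCocone
    (Limits.colimit.cocone (localCohomology.diagram (localCohomology.idealPowersDiagram J) d))

noncomputable def lcIsColimit (J : Ideal R) (d : ℕ) (M : ModuleCat.{u} R) :
    Limits.IsColimit (lcCocone J d M) :=
  Limits.isColimitOfPreserves _ (Limits.colimit.isColimit _)

/-- The stage maps on old Ext. -/
noncomputable def lcι0 (J : Ideal R) (d : ℕ) (M : ModuleCat.{u} R) (n : ℕ) :
    oExt (Rq J n) M d →ₗ[R] (localCohomology J d).obj M :=
  ((lcCocone J d M).ι.app (Opposite.op (Opposite.op n))).hom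

lemma pres_forget : Limits.PreservesFilteredColimitsOfSize.{0,0} (forget (ModuleCat.{u} R)) :=
  Limits.preservesFilteredColimitsOfSize_shrink.{0, u, 0, u} _

lemma lcι0_surj (J : Ideal R) (d : ℕ) (M : ModuleCat.{u} R) (h : (localCohomology J d).obj M) :
    ∃ n a, lcι0 J d M n a = h := by
  have := pres_forget (R := R)
  obtain ⟨j, y, hy⟩ := Limits.Concrete.isColimit_exists_rep _ (lcIsColimit J d M) h
  exact ⟨j.unop.unop, y, hy⟩

lemma lcι0_compat (J : Ideal R) (d : ℕ) (M : ModuleCat.{u} R) {n m : ℕ} (h : n ≤ m)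
    (b : oExt (Rq J n) M d) :
    lcι0 J d M m ((oMap (Rpr J h) M d).hom b) = lcι0 J d M n b := by
  have := (lcCocone J d M).ι.naturality
    (((homOfLE h).op).op : (Opposite.op (Opposite.op n) : (ℕᵒᵖ)ᵒᵖ) ⟶ Opposite.op (Opposite.op m))
  exact congrArg (fun f => f.hom b) this

lemma lcι0_ker (J : Ideal R) (d : ℕ) (M : ModuleCat.{u} R) {n : ℕ}
    (b : oExt (Rq J n) M d) (ha : lcι0 J d M n b = 0) :
    ∃ (m : ℕ) (h : n ≤ m), (oMap (Rpr J h) M d).hom b = 0 := by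
  have := pres_forget (R := R)
  obtain ⟨k, f, g, hk⟩ := Limits.Concrete.isColimit_exists_of_rep_eq _ (lcIsColimit J d M)
    (i := Opposite.op (Opposite.op n)) (j := Opposite.op (Opposite.op n)) b
    (0 : oExt (Rq J n) M d)
    (ha.trans (map_zero (lcι0 J d M n)).symm)
  exact ⟨k.unop.unop, leOfHom f.unop.unop, hk.trans (map_zero (oMap (Rpr J (leOfHom g.unop.unop)) M d).hom)⟩

/-- The stage maps. -/
noncomputable def lcι (J : Ideal R) (d : ℕ) (M : ModuleCat.{u} R) (n : ℕ) :
    Abelian.Ext (Rq J n) M d →ₗ[R] (localCohomology J d).obj M :=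
  lcι0 J d M n ∘ₗ (extCmp (Rq J n) M d).symm.toLinearMap

lemma lcι_cmp (J : Ideal R) (d : ℕ) (M : ModuleCat.{u} R) (n : ℕ) (b) :
    lcι J d M n (extCmp (Rq J n) M d b) = lcι0 J d M n b := by
  unfold lcι
  rw [LinearMap.comp_apply, LinearEquiv.coe_coe, LinearEquiv.symm_apply_apply]

lemma lcι_surj (J : Ideal R) (d : ℕ) (M : ModuleCat.{u} R) (h : (localCohomology J d).obj M) :
    ∃ n a, lcι J d M n a = h := by
  obtain ⟨n, a, rfl⟩ := lcι0_surj J d M h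
  exact ⟨n, _, lcι_cmp J d M n a⟩

lemma lcι_compat (J : Ideal R) (d : ℕ) (M : ModuleCat.{u} R) {n m : ℕ} (h : n ≤ m)
    (a : Abelian.Ext (Rq J n) M d) :
    lcι J d M m ((Abelian.Ext.mk₀ (Rpr J h)).comp a (zero_add d)) = lcι J d M n a := by
  obtain ⟨b, rfl⟩ := (extCmp (Rq J n) M d).surjective a
  rw [← extCmp_nat, lcι_cmp, lcι_cmp, lcι0_compat]

lemma lcι_ker (J : Ideal R) (d : ℕ) (M : ModuleCat.{u} R) {n : ℕ}
    (a : Abelian.Ext (Rq J n) M d) (ha : lcι J d M n a = 0) :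
    ∃ (m : ℕ) (h : n ≤ m), (Abelian.Ext.mk₀ (Rpr J h)).comp a (zero_add d) = 0 := by
  obtain ⟨b, rfl⟩ := (extCmp (Rq J n) M d).surjective a
  rw [lcι_cmp] at ha
  obtain ⟨m, h, hk⟩ := lcι0_ker J d M b ha
  refine ⟨m, h, ?_⟩
  rw [← extCmp_nat, hk, map_zero]

/-- If `r` kills `X` then it kills Ext. -/
lemma smul_ext_eq_zero {X : ModuleCat.{u} R} {r : R} (hr : ∀ x : X, r • x = 0)
    {M : ModuleCat.{u} R} {d : ℕ} (a : Abelian.Ext X M d) : r • a = 0 := by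
  have h : r • (𝟙 X) = 0 := by
    ext x
    exact hr x
  calc r • a = r • ((Abelian.Ext.mk₀ (𝟙 X)).comp a (zero_add d)) := by rw [Abelian.Ext.mk₀_id_comp]
    _ = (Abelian.Ext.mk₀ (r • 𝟙 X)).comp a (zero_add d) := by
      rw [← Abelian.Ext.smul_comp, Abelian.Ext.mk₀_smul]
    _ = 0 := by rw [h, Abelian.Ext.mk₀_zero, Abelian.Ext.zero_comp]

lemma lcoh_PTors (J : Ideal R) (d : ℕ) (M : ModuleCat.{u} R) (x : R) (hx : x ∈ J) :
    PTors x ((localCohomology J d).obj M) := by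
  intro h
  obtain ⟨n, a, rfl⟩ := lcι_surj J d M h
  refine ⟨n, ?_⟩
  rw [← map_smul, smul_ext_eq_zero, map_zero]
  intro y
  obtain ⟨z, rfl⟩ := Ideal.Quotient.mk_surjective y
  change Ideal.Quotient.mk (J ^ n) (x ^ n * z) = 0
  rw [Ideal.Quotient.eq_zero_iff_mem]
  exact Ideal.mul_mem_right _ _ (Ideal.pow_mem_pow hx n)

end P6
end CMProof

open Paper

namespace CMProof
section P7
open scoped Pointwise
variable {R : Type u} [CommRing R]

/-- The short complex attached to an exact pair. -/
noncomputable abbrev sesOf {A B C : Type u} [AddCommGroup A] [AddCommGroup B] [AddCommGroup C]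
    [Module R A] [Module R B] [Module R C] (f : A →ₗ[R] B) (g : B →ₗ[R] C)
    (h : Function.Exact f g) : ShortComplex (ModuleCat.{u} R) :=
  ShortComplex.mk (ModuleCat.ofHom f) (ModuleCat.ofHom g)
    (by apply ModuleCat.hom_ext; exact h.linearMap_comp_eq_zero)

lemma sesOf_shortExact {A B C : Type u} [AddCommGroup A] [AddCommGroup B] [AddCommGroup C]
    [Module R A] [Module R B] [Module R C] (f : A →ₗ[R] B) (g : B →ₗ[R] C)
    (h : Function.Exact f g) (hf : Function.Injective f) (hg : Function.Surjective g) :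
    (sesOf f g h).ShortExact := by
  refine ShortComplex.ShortExact.mk' ?_ ?_ ?_
  · rw [ShortComplex.ShortExact.moduleCat_exact_iff_function_exact]
    exact h
  · rw [ModuleCat.mono_iff_injective]
    exact hf
  · rw [ModuleCat.epi_iff_surjective]
    exact hg

lemma pd_of_exact {A B C : Type u} [AddCommGroup A] [AddCommGroup B] [AddCommGroup C]
    [Module R A] [Module R B] [Module R C] (f : A →ₗ[R] B) (g : B →ₗ[R] C)
    (h : Function.Exact f g) (hf : Function.Injective f) (hg : Function.Surjective g) (n : ℕ)
    (hA : HasProjectiveDimensionLT (ModuleCat.of R A) n)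
    (hB : HasProjectiveDimensionLT (ModuleCat.of R B) (n+1)) :
    HasProjectiveDimensionLT (ModuleCat.of R C) (n+1) :=
  (sesOf_shortExact f g h hf hg).hasProjectiveDimensionLT_X₃ n hA hB

lemma finsupp_exact {I : Type*} {A B C : Type*} [AddCommGroup A] [AddCommGroup B] [AddCommGroup C]
    [Module R A] [Module R B] [Module R C] (f : A →ₗ[R] B) (g : B →ₗ[R] C)
    (h : Function.Exact f g) :
    Function.Exact (Finsupp.mapRange.linearMap (α := I) f) (Finsupp.mapRange.linearMap (α := I) g) := by
  intro v
  constructor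
  · intro hv
    have h2 : ∀ b : B, ∃ a, g b = 0 → f a = b := by
      intro b
      by_cases hb : g b = 0
      · obtain ⟨a, ha⟩ := (h b).1 hb
        exact ⟨a, fun _ => ha⟩
      · exact ⟨0, fun h => absurd h hb⟩
    choose q hq using h2
    classical
    let q' : B → A := fun b => if b = 0 then 0 else q b
    refine ⟨Finsupp.mapRange q' (if_pos rfl) v, ?_⟩
    ext i
    have h3 : g (v i) = 0 := DFunLike.congr_fun hv i
    rw [Finsupp.mapRange.linearMap_apply, Finsupp.mapRange_apply, Finsupp.mapRange_apply]
    by_cases h0 : v i = 0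
    · rw [h0]; simp [q']
    · simp only [q', if_neg h0]
      exact hq _ h3
  · rintro ⟨w, rfl⟩
    ext i
    exact h.apply_apply_eq_zero (w i)

lemma proj_finsupp_nat (M : Type*) [AddCommGroup M] [Module R M] [Module.Projective R M] :
    Module.Projective R (ℕ →₀ M) := by
  classical
  exact Module.Projective.of_equiv (finsuppLequivDFinsupp (ι := ℕ) (M := M) R).symm

lemma pd_finsupp_nat (n : ℕ) (M : ModuleCat.{u} R) (h : HasProjectiveDimensionLT M (n+1)) :
    HasProjectiveDimensionLT (ModuleCat.of R (ℕ →₀ M)) (n+1) := by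
  rw [← resDimLE_proj_iff] at h
  induction n generalizing M with
  | zero =>
    have h' : Module.Projective R M := h
    rw [← resDimLE_proj_iff]
    exact proj_finsupp_nat M
  | succ n ih =>
    rcases h with h | ⟨X, f, hX, hf, hk⟩
    · have := ih M h
      exact hasProjectiveDimensionLT_of_ge _ (n+1) _ (by lia)
    · have h1 := ih _ hk
      have : Module.Projective R X := hX
      have : Module.Projective R (ℕ →₀ X) := proj_finsupp_nat X
      have : Projective (ModuleCat.of R (ℕ →₀ X)) := (IsProjective.iff_projective _).1 this
      exact pd_of_exact (Finsupp.mapRange.linearMap (LinearMap.ker f).subtype)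
        (Finsupp.mapRange.linearMap f)
        (finsupp_exact _ _ (LinearMap.exact_subtype_ker_map f))
        (Finsupp.mapRange_injective _ (map_zero _) Subtype.val_injective)
        (Finsupp.mapRange_surjective _ (map_zero _) hf) (n+1) h1 inferInstance

section telescope
variable {M : Type u} [AddCommGroup M] [Module R M] (x : R)

/-- shift -/
noncomputable def tsh : (ℕ →₀ M) →ₗ[R] (ℕ →₀ M) := Finsupp.lmapDomain M R Nat.succ

lemma tsh_zero (f : ℕ →₀ M) : tsh (R := R) f 0 = 0 :=
  Finsupp.mapDomain_of_notMem_range _ _ (by simp)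

lemma tsh_succ (f : ℕ →₀ M) (n : ℕ) : tsh (R := R) f (n+1) = f n :=
  Finsupp.mapDomain_apply Nat.succ_injective f n

/-- telescope map -/
noncomputable def tel : (ℕ →₀ M) →ₗ[R] (ℕ →₀ M) := LinearMap.id - x • tsh

lemma tel_apply (f : ℕ →₀ M) : tel x f = f - x • tsh (R := R) f := rfl

lemma tel_zero (f : ℕ →₀ M) : tel x f 0 = f 0 := by
  rw [tel_apply, Finsupp.sub_apply, Finsupp.smul_apply, tsh_zero, smul_zero, sub_zero]

lemma tel_succ (f : ℕ →₀ M) (n : ℕ) : tel x f (n+1) = f (n+1) - x • f n := by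
  rw [tel_apply, Finsupp.sub_apply, Finsupp.smul_apply, tsh_succ]

lemma tel_inj : Function.Injective (tel x : (ℕ →₀ M) →ₗ[R] (ℕ →₀ M)) := by
  rw [injective_iff_map_eq_zero]
  intro f hf
  ext n
  induction n with
  | zero => rw [← tel_zero x f, hf]
  | succ n ih =>
    have := tel_succ x f n
    rw [hf, ih] at this
    simpa using this.symm

variable (M) in
/-- The localization `M_x` as a telescope. -/
abbrev Lx : Type u := (ℕ →₀ M) ⧸ LinearMap.range (tel x : (ℕ →₀ M) →ₗ[R] (ℕ →₀ M))

/-- the shift on `Lx` -/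
noncomputable def Ls : Lx M x →ₗ[R] Lx M x :=
  Submodule.mapQ _ _ tsh (by
    rintro _ ⟨f, rfl⟩
    exact ⟨tsh f, by rw [tel_apply, tel_apply, map_sub, map_smul]⟩)

lemma Ls_mk (f : ℕ →₀ M) : Ls x (Submodule.Quotient.mk f : Lx M x) =
  (Submodule.Quotient.mk (tsh (R := R) f) : Lx M x) := rfl

lemma smul_Ls (v : Lx M x) : x • Ls x v = v := by
  obtain ⟨f, rfl⟩ := Submodule.Quotient.mk_surjective _ v
  rw [Ls_mk, ← Submodule.Quotient.mk_smul, eq_comm, Submodule.Quotient.eq]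
  exact ⟨f, rfl⟩

/-- The map `M → M_x`. -/
noncomputable def Lι : M →ₗ[R] Lx M x := Submodule.mkQ _ ∘ₗ Finsupp.lsingle 0

lemma Lι_inj (hx : IsSMulRegular M x) : Function.Injective (Lι x : M →ₗ[R] Lx M x) := by
  rw [injective_iff_map_eq_zero]
  intro m hm
  obtain ⟨f, hf⟩ := (Submodule.Quotient.mk_eq_zero _).1 hm
  have h0 : f 0 = m := by
    rw [← tel_zero x f, hf]; exact Finsupp.single_eq_same
  have h1 : ∀ n, f n = x ^ n • m := by
    intro n
    induction n with
    | zero => rw [h0, pow_zero, one_smul]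
    | succ n ih =>
      have := tel_succ x f n
      rw [hf, Finsupp.lsingle_apply, Finsupp.single_eq_of_ne (by simp), eq_comm, sub_eq_zero] at this
      rw [this, ih, pow_succ', mul_smul]
  obtain ⟨n, hn⟩ := Infinite.exists_notMem_finset f.support
  rw [Finsupp.notMem_support_iff, h1] at hn
  exact (hx.pow n).right_eq_zero_of_smul hn

variable (M) in
/-- `N = M_x / M`. -/
abbrev Nx : Type u := Lx M x ⧸ LinearMap.range (Lι x : M →ₗ[R] Lx M x)

lemma PTors.add' {N : Type*} [AddCommGroup N] [Module R N] {y : R} {a b : N}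
    (ha : ∃ k, y ^ k • a = 0) (hb : ∃ k, y ^ k • b = 0) : ∃ k, y ^ k • (a + b) = 0 := by
  obtain ⟨k, hk⟩ := ha
  obtain ⟨l, hl⟩ := hb
  refine ⟨k + l, ?_⟩
  rw [smul_add, pow_add, mul_smul _ _ b, hl, mul_comm, mul_smul, hk, smul_zero, smul_zero, add_zero]

lemma PTors_finsupp {y : R} (h : PTors y M) : PTors y (ℕ →₀ M) := by
  intro f
  induction f using Finsupp.induction_linear with
  | zero => exact ⟨0, smul_zero _⟩
  | add f g hf hg => exact PTors.add' hf hg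
  | single n m =>
    obtain ⟨k, hk⟩ := h m
    exact ⟨k, by rw [Finsupp.smul_single, hk, Finsupp.single_zero]⟩

lemma PTors_surj {A B : Type*} [AddCommGroup A] [AddCommGroup B] [Module R A] [Module R B]
    (f : A →ₗ[R] B) (hf : Function.Surjective f) {y : R} (h : PTors y A) : PTors y B := by
  intro b
  obtain ⟨a, rfl⟩ := hf b
  obtain ⟨k, hk⟩ := h a
  exact ⟨k, by rw [← map_smul, hk, map_zero]⟩

lemma PTors_Nx {y : R} (h : PTors y M) : PTors y (Nx M x) :=
  PTors_surj (Submodule.mkQ _) (Submodule.mkQ_surjective _)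
    (PTors_surj (Submodule.mkQ _) (Submodule.mkQ_surjective _) (PTors_finsupp h))

lemma Nx_PTors : PTors x (Nx M x) := by
  intro v
  obtain ⟨w, rfl⟩ := Submodule.Quotient.mk_surjective _ v
  obtain ⟨f, rfl⟩ := Submodule.Quotient.mk_surjective _ w
  have key : ∀ (n : ℕ) (m : M), x ^ n • (Submodule.Quotient.mk (Finsupp.single n m) : Lx M x) =
      Lι x m := by
    intro n m
    induction n with
    | zero => rw [pow_zero, one_smul]; rfl
    | succ n ih =>
      have : (Submodule.Quotient.mk (Finsupp.single (n+1) m) : Lx M x) =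
          Ls x (Submodule.Quotient.mk (Finsupp.single n m) : Lx M x) := by
        rw [Ls_mk]; congr 1; exact (Finsupp.mapDomain_single (f := Nat.succ) (a := n) (b := m)).symm
      rw [pow_succ, mul_smul, this, smul_Ls, ih]
  induction f using Finsupp.induction_linear with
  | zero => exact ⟨0, by rw [Submodule.Quotient.mk_zero, Submodule.Quotient.mk_zero, smul_zero]⟩
  | add f g hf hg => 
    rw [Submodule.Quotient.mk_add, Submodule.Quotient.mk_add]
    exact PTors.add' hf hg
  | single n m =>
    refine ⟨n, ?_⟩
    rw [← Submodule.Quotient.mk_smul, key, Submodule.Quotient.mk_eq_zero]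
    exact ⟨m, rfl⟩

lemma pd_Lx (a : ℕ) (h : HasProjectiveDimensionLT (ModuleCat.of R M) (a+1)) :
    HasProjectiveDimensionLT (ModuleCat.of R (Lx M x)) (a+1+1) := by
  have h1 := pd_finsupp_nat a (ModuleCat.of R M) h
  exact pd_of_exact (tel x) (Submodule.mkQ _) (LinearMap.exact_map_mkQ_range _) (tel_inj x)
    (Submodule.mkQ_surjective _) (a+1) h1 (hasProjectiveDimensionLT_of_ge _ (a+1) _ (by lia))

lemma pd_Nx (hx : IsSMulRegular M x) (a : ℕ) (h : HasProjectiveDimensionLT (ModuleCat.of R M) (a+1)) :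
    HasProjectiveDimensionLT (ModuleCat.of R (Nx M x)) (a+1+1) :=
  pd_of_exact (Lι x) (Submodule.mkQ _) (LinearMap.exact_map_mkQ_range _) (Lι_inj x hx)
    (Submodule.mkQ_surjective _) (a+1) h (pd_Lx x a h)

end telescope

lemma wreg_of_divisible (x : R) (l : List R) {A N : Type u} [AddCommGroup A] [AddCommGroup N]
    [Module R A] [Module R N] (i : A →ₗ[R] N) (hi : Function.Injective i)
    (hex : Function.Exact i (x • LinearMap.id : N →ₗ[R] N))
    (hs : Function.Surjective (x • LinearMap.id : N →ₗ[R] N)) (ht : PTors x N)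
    (hl : RingTheory.Sequence.IsWeaklyRegular A l) : RingTheory.Sequence.IsWeaklyRegular N l := by
  induction l generalizing A N with
  | nil => exact RingTheory.Sequence.IsWeaklyRegular.nil R N
  | cons y l ih =>
    rw [RingTheory.Sequence.isWeaklyRegular_cons_iff] at hl ⊢
    have hy : IsSMulRegular N y := by
      rw [isSMulRegular_iff_right_eq_zero_of_smul]
      have : ∀ k, ∀ v : N, x ^ k • v = 0 → y • v = 0 → v = 0 := by
        intro k
        induction k with
        | zero => intro v hv _; rwa [pow_zero, one_smul] at hv
        | succ k ihk =>
          intro v hv hyv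
          have h1 : x • v = 0 := by
            refine ihk (x • v) ?_ ?_
            · rw [smul_smul, ← pow_succ, hv]
            · rw [smul_comm, hyv, smul_zero]
          obtain ⟨a, rfl⟩ := (hex v).1 h1
          have h2 : y • a = 0 := hi (by rw [map_smul, hyv, map_zero])
          rw [hl.1.right_eq_zero_of_smul h2, map_zero]
      intro v hv
      obtain ⟨k, hk⟩ := ht v
      exact this k v hk hv
    refine ⟨hy, ?_⟩
    have hm : QuotSMulTop.map y (x • LinearMap.id : N →ₗ[R] N) = x • LinearMap.id := by
      rw [map_smul, QuotSMulTop.map_id]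
    refine ih (QuotSMulTop.map y i) ?_ ?_ ?_ ?_ hl.2
    · have h0 : Function.Exact (0 : PUnit.{u+1} →ₗ[R] A) i := by
        intro a
        constructor
        · intro ha
          exact ⟨0, (hi (ha.trans (map_zero i).symm)).symm⟩
        · rintro ⟨_, rfl⟩
          exact map_zero i
      have h1 := QuotSMulTop.map_first_exact_on_four_term_exact_of_isSMulRegular_last h0 hex hy
      rw [injective_iff_map_eq_zero]
      intro v hv
      obtain ⟨w, rfl⟩ := (h1 v).1 hv
      rw [map_zero, LinearMap.zero_apply]
    · rw [← hm]
      exact QuotSMulTop.map_exact y hex hs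
    · rw [← hm]
      exact QuotSMulTop.map_surjective y hs
    · exact PTors_surj (Submodule.mkQ _) (Submodule.mkQ_surjective _) ht

lemma wreg_Nx {M : Type u} [AddCommGroup M] [Module R M] (x : R) (l : List R)
    (hx : IsSMulRegular M x) (hl : RingTheory.Sequence.IsWeaklyRegular (QuotSMulTop x M) l) :
    RingTheory.Sequence.IsWeaklyRegular (Nx M x) l := by
  let j : M →ₗ[R] Nx M x := Submodule.mkQ _ ∘ₗ Ls x ∘ₗ Lι x
  have hj : ∀ m, j m = 0 ↔ ∃ m', x • m' = m := by
    intro m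
    constructor
    · intro h
      obtain ⟨m', hm'⟩ := (Submodule.Quotient.mk_eq_zero _).1 h
      refine ⟨m', Lι_inj x hx ?_⟩
      rw [map_smul, hm']
      exact smul_Ls x (Lι x m)
    · rintro ⟨m', rfl⟩
      refine (Submodule.Quotient.mk_eq_zero _).2 ⟨m', ?_⟩
      rw [LinearMap.comp_apply, map_smul, map_smul, smul_Ls]
  let i : QuotSMulTop x M →ₗ[R] Nx M x := Submodule.liftQ _ j (by
    intro m hm
    obtain ⟨m', -, rfl⟩ := (Submodule.mem_smul_pointwise_iff_exists _ _ _).1 hm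
    exact (hj _).2 ⟨m', rfl⟩)
  refine wreg_of_divisible x l i ?_ ?_ ?_ (Nx_PTors x) hl
  · rw [injective_iff_map_eq_zero]
    intro v hv
    obtain ⟨m, rfl⟩ := Submodule.Quotient.mk_surjective _ v
    obtain ⟨m', rfl⟩ := (hj m).1 hv
    exact (Submodule.Quotient.mk_eq_zero _).2 (Submodule.smul_mem_pointwise_smul m' x ⊤ trivial)
  · intro v
    constructor
    · intro hv
      obtain ⟨w, rfl⟩ := Submodule.Quotient.mk_surjective _ v
      obtain ⟨m, hm⟩ := (Submodule.Quotient.mk_eq_zero _).1 hv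
      refine ⟨Submodule.Quotient.mk m, ?_⟩
      change Submodule.Quotient.mk (Ls x (Lι x m)) = _
      congr 1
      rw [hm]
      change Ls x (x • w) = w
      rw [map_smul, smul_Ls]
    · rintro ⟨v, rfl⟩
      obtain ⟨m, rfl⟩ := Submodule.Quotient.mk_surjective _ v
      refine (Submodule.Quotient.mk_eq_zero _).2 ⟨m, ?_⟩
      exact (smul_Ls x (Lι x m)).symm
  · intro v
    obtain ⟨w, rfl⟩ := Submodule.Quotient.mk_surjective _ v
    refine ⟨Submodule.Quotient.mk (Ls x w), ?_⟩
    change Submodule.Quotient.mk (x • Ls x w) = _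
    rw [smul_Ls]

lemma ext_Lx_zero {M : Type u} [AddCommGroup M] [Module R M] (x : R) (X : ModuleCat.{u} R)
    (k : ℕ) (hk : ∀ v : X, x ^ k • v = 0) (j : ℕ)
    (a : Abelian.Ext X (ModuleCat.of R (Lx M x)) j) : a = 0 := by
  have h1 : ∀ b : Abelian.Ext X (ModuleCat.of R (Lx M x)) j, x • b = 0 → b = 0 := by
    intro b hb
    have e : (x • ModuleCat.ofHom (Ls x) : ModuleCat.of R (Lx M x) ⟶ ModuleCat.of R (Lx M x)) = 𝟙 _ := by
      apply ModuleCat.hom_ext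
      apply LinearMap.ext
      intro v
      exact smul_Ls x v
    calc b = b.comp (Abelian.Ext.mk₀ (𝟙 _)) (add_zero j) := by rw [Abelian.Ext.comp_mk₀_id]
      _ = (x • b).comp (Abelian.Ext.mk₀ (ModuleCat.ofHom (Ls x))) (add_zero j) := by
        rw [← e, Abelian.Ext.mk₀_smul, Abelian.Ext.comp_smul, Abelian.Ext.smul_comp]
      _ = 0 := by rw [hb, Abelian.Ext.zero_comp]
  have h2 : ∀ n, ∀ b : Abelian.Ext X (ModuleCat.of R (Lx M x)) j, x ^ n • b = 0 → b = 0 := by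
    intro n
    induction n with
    | zero => intro b hb; rwa [pow_zero, one_smul] at hb
    | succ n ih =>
      intro b hb
      rw [pow_succ', mul_smul] at hb
      exact ih b (h1 _ hb)
  exact h2 k a (smul_ext_eq_zero hk a)

lemma exists_G (rs : List R) (M : Type u) [AddCommGroup M] [Module R M]
    (hr : RingTheory.Sequence.IsWeaklyRegular M rs) (a : ℕ)
    (hM : HasProjectiveDimensionLT (ModuleCat.of R M) (a+1)) :
    ∃ (G : ModuleCat.{u} R) (α : Abelian.Ext G (ModuleCat.of R M) rs.length),
      HasProjectiveDimensionLT G (a + rs.length + 1) ∧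
      (∀ y : R, PTors y M → PTors y G) ∧ (∀ y ∈ rs, PTors y G) ∧
      ∀ X : ModuleCat.{u} R, (∀ y ∈ rs, ∃ k, ∀ v : X, y ^ k • v = 0) →
        ∀ (j n : ℕ) (h : j + rs.length = n), Function.Bijective (post X α h) := by
  induction rs generalizing M a with
  | nil =>
    refine ⟨ModuleCat.of R M, Abelian.Ext.mk₀ (𝟙 _), hM, fun _ h => h, by simp, ?_⟩
    intro X _ j n h
    obtain rfl : j = n := h
    have : ∀ b, post X (Abelian.Ext.mk₀ (𝟙 (ModuleCat.of R M))) (add_zero j) b = b := fun b =>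
      Abelian.Ext.comp_mk₀_id b
    change Function.Bijective (post X (Abelian.Ext.mk₀ (𝟙 (ModuleCat.of R M))) (add_zero j))
    rw [show ⇑(post X (Abelian.Ext.mk₀ (𝟙 (ModuleCat.of R M))) (add_zero j)) = id from
      funext this]
    exact Function.bijective_id
  | cons x l ih =>
    rw [RingTheory.Sequence.isWeaklyRegular_cons_iff] at hr
    obtain ⟨G, α, h1, h2, h3, h4⟩ := ih (Nx M x) (wreg_Nx x l hr.1 hr.2) (a+1) (pd_Nx x hr.1 a hM)
    have hS := sesOf_shortExact (Lι x : M →ₗ[R] Lx M x) (Submodule.mkQ _)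
      (LinearMap.exact_map_mkQ_range _) (Lι_inj x hr.1) (Submodule.mkQ_surjective _)
    refine ⟨G, α.comp hS.extClass rfl, ?_, ?_, ?_, ?_⟩
    · rw [List.length_cons, add_comm l.length, ← add_assoc]; exact h1
    · exact fun y hy => h2 y (PTors_Nx x hy)
    · intro y hy
      rcases List.mem_cons.1 hy with rfl | hy
      · exact h2 _ (Nx_PTors _)
      · exact h3 y hy
    · intro X hX j n h
      obtain ⟨k, hk⟩ := hX x List.mem_cons_self
      have hb := h4 X (fun y hy => hX y (List.mem_cons_of_mem _ hy)) j _ rfl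
      have e : ∀ b, post X (α.comp hS.extClass rfl) h b =
          post X hS.extClass (by rw [← h, List.length_cons, add_assoc]) (post X α rfl b) := by
        intro b
        rw [post_apply, post_apply, post_apply]
        exact (Abelian.Ext.comp_assoc _ _ _ _ _ (by rw [← h, List.length_cons, add_assoc])).symm
      have hδ : Function.Bijective (post X hS.extClass
          (show j + l.length + 1 = n by rw [← h, List.length_cons, add_assoc])) := by
        constructor
        · rw [injective_iff_map_eq_zero]
          intro b hb
          obtain ⟨c, rfl⟩ := Abelian.Ext.covariant_sequence_exact₃ X hS b
            (show j + l.length + 1 = n by rw [← h, List.length_cons, add_assoc]) hb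
          have : c = 0 := ext_Lx_zero x X k hk _ c
          rw [this, Abelian.Ext.zero_comp]
        · intro b
          obtain ⟨c, hc⟩ := Abelian.Ext.covariant_sequence_exact₁ X hS b
            (ext_Lx_zero x X k hk _ _) (show j + l.length + 1 = n by
              rw [← h, List.length_cons, add_assoc])
          exact ⟨c, hc⟩
      rw [show ⇑(post X (α.comp hS.extClass rfl) h) = _ ∘ _ from funext e]
      exact hδ.comp hb

end P7
end CMProof

open Paper

namespace CMProof
section P8
variable {R : Type u} [CommRing R]

section compare
variable (J : Ideal R) (d : ℕ) (M G : ModuleCat.{u} R) (α : Abelian.Ext G M d)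

/-- Comparison map at level `n`. -/
noncomputable def Psi (n : ℕ) (φ : Rq J n ⟶ G) : (localCohomology J d).obj M :=
  lcι J d M n (post (Rq J n) α (zero_add d) (Abelian.Ext.mk₀ φ))

lemma Psi_add (n : ℕ) (φ ψ : Rq J n ⟶ G) : Psi J d M G α n (φ + ψ) =
    Psi J d M G α n φ + Psi J d M G α n ψ := by
  unfold Psi
  rw [Abelian.Ext.mk₀_add, map_add, map_add]

lemma Psi_smul (n : ℕ) (r : R) (φ : Rq J n ⟶ G) : Psi J d M G α n (r • φ) =
    r • Psi J d M G α n φ := by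
  unfold Psi
  rw [Abelian.Ext.mk₀_smul, map_smul, map_smul]

lemma mk₀_post {n m : ℕ} (h : n ≤ m) (φ : Rq J n ⟶ G) :
    (Abelian.Ext.mk₀ (Rpr J h)).comp (post (Rq J n) α (zero_add d) (Abelian.Ext.mk₀ φ))
      (zero_add d) = post (Rq J m) α (zero_add d) (Abelian.Ext.mk₀ (Rpr J h ≫ φ)) := by
  rw [post_apply, post_apply, Abelian.Ext.mk₀_comp_mk₀_assoc]

lemma Psi_compat {n m : ℕ} (h : n ≤ m) (φ : Rq J n ⟶ G) :
    Psi J d M G α m (Rpr J h ≫ φ) = Psi J d M G α n φ := by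
  unfold Psi
  rw [← mk₀_post, lcι_compat]

/-- The map `R/J^n → G` attached to an element killed by `J^n`. -/
noncomputable def evG (n : ℕ) (g : G) (hg : ∀ r ∈ J ^ n, r • g = 0) : Rq J n ⟶ G :=
  ModuleCat.ofHom (Submodule.liftQ (J ^ n) (LinearMap.toSpanSingleton R G g) hg)

lemma evG_mk (n : ℕ) (g : G) (hg : ∀ r ∈ J ^ n, r • g = 0) (r : R) :
    (evG J G n g hg).hom (Submodule.Quotient.mk r) = r • g := rfl

lemma hom_Rq_ext (n : ℕ) (φ ψ : Rq J n ⟶ G)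
    (h : φ.hom (Submodule.Quotient.mk (1 : R)) = ψ.hom (Submodule.Quotient.mk (1 : R))) : φ = ψ := by
  apply ModuleCat.hom_ext
  apply LinearMap.ext
  intro v
  obtain ⟨r, rfl⟩ := Submodule.Quotient.mk_surjective _ v
  have : (Submodule.Quotient.mk r : R ⧸ (J ^ n)) = r • (Submodule.Quotient.mk (1 : R) : R ⧸ (J^n)) := by
    rw [← Submodule.Quotient.mk_smul, smul_eq_mul, mul_one]
  calc φ.hom (Submodule.Quotient.mk r : R ⧸ (J ^ n)) = r • φ.hom (Submodule.Quotient.mk (1 : R) : R ⧸ (J^n)) := by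
        rw [this]; exact map_smul φ.hom r _
    _ = r • ψ.hom (Submodule.Quotient.mk (1 : R) : R ⧸ (J^n)) := by rw [h]
    _ = _ := by rw [this]; exact (map_smul ψ.hom r _).symm

lemma Rpr_evG {n m : ℕ} (h : n ≤ m) (g : G) (hg : ∀ r ∈ J ^ n, r • g = 0)
    (hg' : ∀ r ∈ J ^ m, r • g = 0) : Rpr J h ≫ evG J G n g hg = evG J G m g hg' := by
  apply hom_Rq_ext
  rfl

variable (hG : ∀ g : G, ∃ n : ℕ, ∀ r ∈ J ^ n, r • g = 0)

/-- The comparison map. -/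
noncomputable def theta (g : G) : (localCohomology J d).obj M :=
  Psi J d M G α (hG g).choose (evG J G _ g (hG g).choose_spec)

lemma theta_eq (g : G) (n : ℕ) (hn : ∀ r ∈ J ^ n, r • g = 0) :
    theta J d M G α hG g = Psi J d M G α n (evG J G n g hn) := by
  unfold theta
  have hm : ∀ r ∈ J ^ (max (hG g).choose n), r • g = 0 := fun r hr =>
    hn r (Ideal.pow_le_pow_right (le_max_right _ _) hr)
  rw [← Psi_compat J d M G α (le_max_left (hG g).choose n), Rpr_evG J G _ g _ hm,
    ← Rpr_evG J G (le_max_right (hG g).choose n) g hn hm, Psi_compat]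

/-- The comparison map, linear version. -/
noncomputable def thetaL : G →ₗ[R] (localCohomology J d).obj M where
  toFun := theta J d M G α hG
  map_add' a b := by
    obtain ⟨n, hn⟩ := hG a
    obtain ⟨m, hm⟩ := hG b
    have hn' : ∀ r ∈ J ^ (max n m), r • a = 0 := fun r hr =>
      hn r (Ideal.pow_le_pow_right (le_max_left _ _) hr)
    have hm' : ∀ r ∈ J ^ (max n m), r • b = 0 := fun r hr =>
      hm r (Ideal.pow_le_pow_right (le_max_right _ _) hr)
    have hs : ∀ r ∈ J ^ (max n m), r • (a + b) = 0 := fun r hr => by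
      rw [smul_add, hn' r hr, hm' r hr, add_zero]
    rw [theta_eq _ _ _ _ _ _ a _ hn', theta_eq _ _ _ _ _ _ b _ hm', theta_eq _ _ _ _ _ _ _ _ hs,
      ← Psi_add]
    congr 1
    apply hom_Rq_ext
    change (1 : R) • (a + b) = (1 : R) • a + (1 : R) • b
    rw [smul_add]
  map_smul' c a := by
    obtain ⟨n, hn⟩ := hG a
    have hs : ∀ r ∈ J ^ n, r • (c • a) = 0 := fun r hr => by
      rw [smul_comm, hn r hr, smul_zero]
    rw [theta_eq _ _ _ _ _ _ a _ hn, theta_eq _ _ _ _ _ _ _ _ hs, RingHom.id_apply, ← Psi_smul]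
    congr 1
    apply hom_Rq_ext
    change (1 : R) • (c • a) = c • ((1 : R) • a)
    rw [smul_comm]

lemma thetaL_bij (hb : ∀ n, Function.Bijective (post (Rq J n) α (zero_add d))) :
    Function.Bijective (thetaL J d M G α hG) := by
  constructor
  · rw [injective_iff_map_eq_zero]
    intro g hg
    obtain ⟨n, hn⟩ := hG g
    have h1 : Psi J d M G α n (evG J G n g hn) = 0 := (theta_eq J d M G α hG g n hn).symm.trans hg
    obtain ⟨m, hm, h2⟩ := lcι_ker J d M _ h1
    rw [mk₀_post] at h2
    have h3 := (hb m).1 (h2.trans (map_zero _).symm)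
    have h4 : Rpr J hm ≫ evG J G n g hn = 0 := by
      rwa [Abelian.Ext.mk₀_eq_zero_iff] at h3
    have h5 : (Rpr J hm ≫ evG J G n g hn).hom (Submodule.Quotient.mk (1 : R)) = 0 := by
      rw [h4]; rfl
    exact (one_smul R g).symm.trans h5
  · intro h
    obtain ⟨n, a, rfl⟩ := lcι_surj J d M h
    obtain ⟨b, rfl⟩ := (hb n).2 a
    obtain ⟨φ, rfl⟩ := Abelian.Ext.mk₀_bijective _ _ |>.2 b
    let g : G := φ.hom (Submodule.Quotient.mk (1 : R) : R ⧸ (J ^ n))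
    have hg : ∀ r ∈ J ^ n, r • g = 0 := by
      intro r hr
      have h0 : r • (Submodule.Quotient.mk (1 : R) : R ⧸ (J^n)) = 0 := by
        rw [← Submodule.Quotient.mk_smul, smul_eq_mul, mul_one, Submodule.Quotient.mk_eq_zero]
        exact hr
      refine (map_smul φ.hom r _).symm.trans ?_
      exact (congrArg φ.hom h0).trans (map_zero φ.hom)
    refine ⟨g, (theta_eq J d M G α hG g n hg).trans ?_⟩
    have : evG J G n g hg = φ := by
      apply hom_Rq_ext
      exact one_smul R g
    rw [this]
    rfl

end compare

end P8
end CMProof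

open Paper

namespace CMProof
section P9
open scoped Pointwise
variable {R : Type u} [CommRing R]

lemma maximalIdeal_le_radical [IsNoetherianRing R] [IsLocalRing R] (rs : List R)
    (hdim : ringKrullDim R = (rs.length : WithBot ℕ∞))
    (reg : RingTheory.Sequence.IsRegular R rs) :
    maximalIdeal R ≤ (Ideal.ofList rs).radical := by
  have h1 := ringKrullDim_add_length_eq_ringKrullDim_of_isRegular rs reg
  rw [hdim] at h1
  have h2 : ringKrullDim (R ⧸ Ideal.ofList rs) ≤ 0 := by
    generalize ringKrullDim (R ⧸ Ideal.ofList rs) = t at h1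
    induction t using WithBot.recBotCoe with
    | bot => exact bot_le
    | coe t =>
      have h3 : t + (rs.length : ℕ∞) = (rs.length : ℕ∞) := by exact_mod_cast h1
      have h4 : t + (rs.length : ℕ∞) ≤ 0 + (rs.length : ℕ∞) := by rw [h3, zero_add]
      have h5 : t ≤ 0 := (ENat.add_le_add_iff_right (ENat.natCast_ne_top _)).1 h4
      exact_mod_cast h5
  have h3 : Ring.KrullDimLE 0 (R ⧸ Ideal.ofList rs) := Ring.krullDimLE_iff.mpr h2
  rw [Ideal.radical_eq_sInf]
  refine le_sInf ?_
  rintro P ⟨hP, hP'⟩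
  have := Ideal.map_isPrime_of_surjective (f := Ideal.Quotient.mk (Ideal.ofList rs))
    Ideal.Quotient.mk_surjective (I := P) (by rwa [Ideal.mk_ker])
  have h5 : (P.map (Ideal.Quotient.mk (Ideal.ofList rs))).IsMaximal := inferInstance
  have h6 := Ideal.comap_isMaximal_of_surjective (Ideal.Quotient.mk (Ideal.ofList rs))
    Ideal.Quotient.mk_surjective (K := P.map (Ideal.Quotient.mk (Ideal.ofList rs)))
  rw [Ideal.comap_map_of_surjective _ Ideal.Quotient.mk_surjective, ← RingHom.ker_eq_comap_bot,
    Ideal.mk_ker, sup_eq_left.2 hP] at h6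
  exact (IsLocalRing.eq_maximalIdeal h6).ge

lemma killed_pow [IsNoetherianRing R] (J : Ideal R) (rs : List R)
    (hJ : J ≤ (Ideal.ofList rs).radical) (G : Type*) [AddCommGroup G] [Module R G]
    (hG : ∀ y ∈ rs, PTors y G) (g : G) : ∃ n : ℕ, ∀ r ∈ J ^ n, r • g = 0 := by
  let I : Ideal R := LinearMap.ker (LinearMap.toSpanSingleton R G g)
  have h1 : Ideal.ofList rs ≤ I.radical := by
    refine Ideal.span_le.2 ?_
    intro y hy
    exact hG y hy g
  have h2 : J ≤ I.radical := hJ.trans ((Ideal.radical_mono h1).trans (Ideal.radical_idem I).le)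
  obtain ⟨n, hn⟩ := Ideal.exists_pow_le_of_le_radical_of_fg h2 (IsNoetherian.noetherian J)
  exact ⟨n, fun r hr => hn hr⟩

lemma ext_descend (H : ModuleCat.{u} R) (rs : List R) (hH : ∀ x ∈ rs, PTors x H)
    (M : Type u) [AddCommGroup M] [Module R M] (hr : RingTheory.Sequence.IsWeaklyRegular M rs)
    (k : ℕ) (h : ∀ N : ModuleCat.{u} R, Subsingleton (Abelian.Ext N (ch H) (k + rs.length))) :
    Subsingleton (Abelian.Ext (ModuleCat.of R M) (ch H) k) := by
  induction rs generalizing M k with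
  | nil => exact h _
  | cons x l ih =>
    rw [RingTheory.Sequence.isWeaklyRegular_cons_iff] at hr
    have h1 : Subsingleton (Abelian.Ext (ModuleCat.of R (QuotSMulTop x M)) (ch H) (k+1)) := by
      refine ih (fun y hy => hH y (List.mem_cons_of_mem _ hy)) (QuotSMulTop x M) hr.2 (k+1) ?_
      intro N
      rw [add_assoc, add_comm 1]
      exact h N
    refine XC.subsingleton (XC_ext_ch (hH x List.mem_cons_self) k _) ?_
    intro a
    have hex : Function.Exact (x • LinearMap.id : M →ₗ[R] M)
        (Submodule.mkQ (x • (⊤ : Submodule R M))) := by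
      intro m
      rw [Submodule.mkQ_apply, Submodule.Quotient.mk_eq_zero, Submodule.mem_smul_pointwise_iff_exists]
      constructor
      · rintro ⟨b, -, hb⟩
        exact ⟨b, hb⟩
      · rintro ⟨b, hb⟩
        exact ⟨b, trivial, hb⟩
    have hS := sesOf_shortExact (x • LinearMap.id : M →ₗ[R] M) _ hex hr.1
      (Submodule.mkQ_surjective _)
    obtain ⟨b, hb⟩ := Abelian.Ext.contravariant_sequence_exact₁ hS (ch H) a (add_comm 1 k)
      (h1.elim _ _)
    refine ⟨b, ?_⟩
    have e : (sesOf (x • LinearMap.id : M →ₗ[R] M) _ hex).f = x • 𝟙 (ModuleCat.of R M) := rfl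
    rw [← hb, e, Abelian.Ext.mk₀_smul, Abelian.Ext.smul_comp]
    congr 1
    exact Abelian.Ext.mk₀_id_comp b

lemma subsingleton_of_ch (H : ModuleCat.{u} R)
    (h : Subsingleton (Abelian.Ext (ModuleCat.of R R) (ch H) 0)) : Subsingleton H := by
  have e : Abelian.Ext (ModuleCat.of R R) (ch H) 0 ≃ₗ[R] (R →ₗ[R] CharacterModule H) :=
    (Abelian.Ext.linearEquiv₀ (R := R)).trans (ModuleCat.homLinearEquiv (S := R))
  have h1 : Subsingleton (R →ₗ[R] CharacterModule H) := e.symm.toEquiv.subsingleton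
  refine subsingleton_of_forall_eq 0 fun v => ?_
  refine CharacterModule.eq_zero_of_character_apply fun c => ?_
  have h2 : LinearMap.toSpanSingleton R _ c = 0 := h1.elim _ _
  have h3 : (1 : R) • c = 0 := LinearMap.congr_fun h2 1
  rw [one_smul] at h3
  rw [h3]
  rfl

lemma length_le_dim [IsNoetherianRing R] [IsLocalRing R] (d : ℕ)
    (hdim : ringKrullDim R = (d : WithBot ℕ∞)) (rs : List R)
    (reg : RingTheory.Sequence.IsRegular R rs) : rs.length ≤ d := by
  have h1 := ringKrullDim_add_length_eq_ringKrullDim_of_isRegular rs reg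
  rw [hdim] at h1
  generalize ringKrullDim (R ⧸ Ideal.ofList rs) = t at h1
  induction t using WithBot.recBotCoe with
  | bot => rw [WithBot.bot_add] at h1; exact absurd h1.symm (WithBot.coe_ne_bot (a := (d : ℕ∞)))
  | coe t =>
    have h3 : t + (rs.length : ℕ∞) = (d : ℕ∞) := by exact_mod_cast h1
    have h4 : (rs.length : ℕ∞) ≤ (d : ℕ∞) := by rw [← h3]; exact le_add_self
    exact_mod_cast h4

lemma moduleDim_self : moduleDim R R = ringKrullDim R := by
  unfold moduleDim
  have : Module.annihilator R R = ⊥ := Module.annihilator_eq_bot.2 inferInstance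
  rw [this]
  exact ringKrullDim_eq_of_ringEquiv (RingEquiv.quotientBot R)

lemma cm_iff [IsNoetherianRing R] [IsLocalRing R] (d : ℕ)
    (hdim : ringKrullDim R = (d : WithBot ℕ∞)) : IsCohenMacaulayRing R ↔
    ∃ rs : List R, rs.length = d ∧ (∀ x ∈ rs, x ∈ maximalIdeal R) ∧
      RingTheory.Sequence.IsRegular R rs := by
  have h0 : IsCohenMacaulayRing R ↔ depth R R = (d : ℕ∞) := by
    unfold IsCohenMacaulayRing IsCohenMacaulayModule
    rw [moduleDim_self, hdim]
    norm_cast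
  rw [h0]
  unfold depth
  constructor
  · intro h
    rcases Nat.eq_zero_or_pos d with rfl | hd
    · exact ⟨[], rfl, by simp, RingTheory.Sequence.IsRegular.nil R R⟩
    · by_contra hcon
      have : sSup {n : ℕ∞ | ∃ rs : List R, (rs.length : ℕ∞) = n ∧
          (∀ x ∈ rs, x ∈ maximalIdeal R) ∧ RingTheory.Sequence.IsRegular R rs} ≤
          ((d - 1 : ℕ) : ℕ∞) := by
        refine sSup_le ?_
        rintro _ ⟨rs, rfl, h1, h2⟩
        have h3 := length_le_dim d hdim rs h2
        have h4 : rs.length ≠ d := fun h4 => hcon ⟨rs, h4, h1, h2⟩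
        have h5 : rs.length ≤ d - 1 := by lia
        exact_mod_cast h5
      rw [h] at this
      have h6 : d ≤ d - 1 := by exact_mod_cast this
      lia
  · rintro ⟨rs, h1, h2, h3⟩
    refine le_antisymm (sSup_le ?_) (le_sSup ⟨rs, by rw [h1], h2, h3⟩)
    rintro _ ⟨rs', rfl, _, h5⟩
    exact_mod_cast length_le_dim d hdim rs' h5

/-- The main upper bound together with non-vanishing. -/
lemma cm_case [IsNoetherianRing R] [IsLocalRing R] (rs : List R)
    (hdim : ringKrullDim R = (rs.length : WithBot ℕ∞)) (hm : ∀ x ∈ rs, x ∈ maximalIdeal R)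
    (reg : RingTheory.Sequence.IsRegular R rs) :
    HasProjectiveDimensionLT ((localCohomology (maximalIdeal R) rs.length).obj (ModuleCat.of R R))
      (rs.length + 1) ∧
    ¬ Subsingleton ((localCohomology (maximalIdeal R) rs.length).obj (ModuleCat.of R R)) := by
  have hP : Projective (ModuleCat.of R R) := (IsProjective.iff_projective _).1 inferInstance
  obtain ⟨G, α, h1, -, h3, h4⟩ := exists_G rs R reg.toIsWeaklyRegular 0 inferInstance
  rw [zero_add] at h1
  have hG : ∀ g : G, ∃ n : ℕ, ∀ r ∈ (maximalIdeal R) ^ n, r • g = 0 :=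
    killed_pow _ rs (maximalIdeal_le_radical rs hdim reg) G h3
  have hX : ∀ n, ∀ y ∈ rs, ∃ k, ∀ v : Rq (maximalIdeal R) n, y ^ k • v = 0 := by
    intro n y hy
    refine ⟨n, fun v => ?_⟩
    obtain ⟨r, rfl⟩ := Submodule.Quotient.mk_surjective _ v
    refine (Submodule.Quotient.mk_eq_zero ((maximalIdeal R) ^ n)).2 (?_ : y ^ n • r ∈ _)
    exact Ideal.mul_mem_right _ _ (Ideal.pow_mem_pow (hm y hy) n)
  have hb := thetaL_bij (maximalIdeal R) rs.length (ModuleCat.of R R) G α hG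
    (fun n => h4 _ (hX n) 0 _ _)
  let e := LinearEquiv.ofBijective _ hb
  refine ⟨hasProjectiveDimensionLT_of_iso e.toModuleIso _, fun hs => ?_⟩
  have hGs : Subsingleton G := e.toEquiv.subsingleton
  have hGz : Limits.IsZero G := ModuleCat.isZero_of_subsingleton G
  let K : ModuleCat.{u} R := ModuleCat.of R (R ⧸ maximalIdeal R)
  have hsupp : Module.support R K = PrimeSpectrum.zeroLocus (maximalIdeal R) := by
    rw [Module.support_eq_zeroLocus]
    congr 2
    exact Ideal.annihilator_quotient
  have hlt : maximalIdeal R • (⊤ : Submodule R (ModuleCat.of R R)) < ⊤ := by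
    change maximalIdeal R • (⊤ : Ideal R) < ⊤
    rw [smul_eq_mul, Ideal.mul_top]
    exact lt_top_iff_ne_top.2 (maximalIdeal.isMaximal R).ne_top
  have hfin : Module.Finite R K := inferInstanceAs (Module.Finite R (R ⧸ maximalIdeal R))
  have hfin' : Module.Finite R (ModuleCat.of R R) := inferInstanceAs (Module.Finite R R)
  have hE := ModuleCat.subsingleton_ext_of_exists_isRegular (maximalIdeal R) K hsupp.subset
    (ModuleCat.of R R) hlt rs hm reg
  have hK : ∀ y ∈ rs, ∃ k, ∀ v : K, y ^ k • v = 0 := by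
    intro y hy
    refine ⟨1, fun v => ?_⟩
    obtain ⟨r, rfl⟩ := Submodule.Quotient.mk_surjective _ v
    refine (Submodule.Quotient.mk_eq_zero (maximalIdeal R)).2 (?_ : y ^ 1 • r ∈ _)
    rw [pow_one]
    exact Ideal.mul_mem_right _ _ (hm y hy)
  obtain ⟨rs', h5, h6, h7⟩ := ModuleCat.exists_isRegular_of_exists_subsingleton_ext
    (maximalIdeal R) (rs.length + 1) (ModuleCat.of R R) hlt K hsupp (by
      intro i hi
      rcases Nat.lt_succ_iff_lt_or_eq.1 hi with hi | rfl
      · exact hE i hi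
      · have hb' := h4 K hK 0 _ (zero_add _)
        refine subsingleton_of_forall_eq 0 fun a => ?_
        obtain ⟨b, rfl⟩ := hb'.2 a
        obtain ⟨φ, rfl⟩ := (Abelian.Ext.mk₀_bijective _ _).2 b
        rw [hGz.eq_of_tgt φ 0, Abelian.Ext.mk₀_zero, map_zero])
  have := length_le_dim rs.length hdim rs' h7
  lia

end P9
end CMProof

open Paper IsLocalRing

/-- **Corollary 3.4.** Let `(R, 𝔪)` be a Noetherian local ring with `dim R = d`. Then
`R` is Cohen-Macaulay iff `fd_R H^d_𝔪(R) = d` iff `pd_R H^d_𝔪(R) = d`. -/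
theorem isCohenMacaulayRing_iff_flatDim_localCohomology
    (R : Type u) [CommRing R] [IsNoetherianRing R] [IsLocalRing R]
    (d : ℕ) (hdim : ringKrullDim R = (d : WithBot ℕ∞)) :
    ((IsCohenMacaulayRing R ↔ flatDim R (lcoh R (maximalIdeal R) d R) = d) ∧
     (flatDim R (lcoh R (maximalIdeal R) d R) = d ↔
        projDim R (lcoh R (maximalIdeal R) d R) = d)) := by
  have hfl : flatDim R (lcoh R (maximalIdeal R) d R) = d ↔ _ :=
    CMProof.resDim_eq_iff (fun N => Module.Flat R N)
      ((localCohomology (maximalIdeal R) d).obj (ModuleCat.of R R)) d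
  have hpr : projDim R (lcoh R (maximalIdeal R) d R) = d ↔ _ :=
    CMProof.resDim_eq_iff (fun N => Module.Projective R N)
      ((localCohomology (maximalIdeal R) d).obj (ModuleCat.of R R)) d
  have hT : ∀ x ∈ maximalIdeal R, CMProof.PTors x
      ((localCohomology (maximalIdeal R) d).obj (ModuleCat.of R R)) := fun x hx =>
    CMProof.lcoh_PTors _ _ _ x hx
  have hcm := CMProof.cm_iff d hdim
  have hnil : d = 0 → IsCohenMacaulayRing R := fun h =>
    hcm.2 ⟨[], h.symm, by simp, RingTheory.Sequence.IsRegular.nil R R⟩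
  have reg : ∀ rs : List R, (∀ x ∈ rs, x ∈ maximalIdeal R) →
      RingTheory.Sequence.IsWeaklyRegular R rs → RingTheory.Sequence.IsRegular R rs :=
    fun rs h h' => (IsLocalRing.isRegular_iff_isWeaklyRegular_of_subset_maximalIdeal h).2 h'
  have hA : flatDim R (lcoh R (maximalIdeal R) d R) = d → IsCohenMacaulayRing R := by
    intro h
    obtain ⟨h1, h2⟩ := hfl.1 h
    rcases Nat.eq_zero_or_pos d with hd | hd
    · exact hnil hd
    · rw [CMProof.resDimLE_flat_iff] at h1
      have h3 := h2 (d-1) (by lia)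
      rw [CMProof.resDimLE_flat_iff, Nat.sub_add_cancel hd] at h3
      obtain ⟨rs, h4, h5, h6⟩ := CMProof.exists_regSeq_of_injDim _ hT d h1 h3
      exact hcm.2 ⟨rs, h4, h5, reg rs h5 h6⟩
  have hB : projDim R (lcoh R (maximalIdeal R) d R) = d → IsCohenMacaulayRing R := by
    intro h
    obtain ⟨h1, h2⟩ := hpr.1 h
    rcases Nat.eq_zero_or_pos d with hd | hd
    · exact hnil hd
    · rw [CMProof.resDimLE_proj_iff] at h1
      have h3 := h2 (d-1) (by lia)
      rw [CMProof.resDimLE_proj_iff, Nat.sub_add_cancel hd] at h3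
      obtain ⟨rs, h4, h5, h6⟩ := CMProof.exists_regSeq_of_projDim _ hT d h1 h3
      exact hcm.2 ⟨rs, h4, h5, reg rs h5 h6⟩
  have hC : IsCohenMacaulayRing R → flatDim R (lcoh R (maximalIdeal R) d R) = d ∧
      projDim R (lcoh R (maximalIdeal R) d R) = d := by
    intro h
    obtain ⟨rs, h4, h5, h6⟩ := hcm.1 h
    subst h4
    obtain ⟨h7, h8⟩ := CMProof.cm_case rs hdim h5 h6
    have hp : ResDimLE R (fun N => Module.Projective R N) rs.length
        ((localCohomology (maximalIdeal R) rs.length).obj (ModuleCat.of R R)) :=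
      (CMProof.resDimLE_proj_iff _ _).2 h7
    have hmono : ∀ k, ResDimLE R (fun N => Module.Projective R N) k
        ((localCohomology (maximalIdeal R) rs.length).obj (ModuleCat.of R R)) →
        ResDimLE R (fun N => Module.Flat R N) k
        ((localCohomology (maximalIdeal R) rs.length).obj (ModuleCat.of R R)) := by
      intro k hk
      rw [CMProof.resDimLE_proj_iff] at hk
      rw [CMProof.resDimLE_flat_iff]
      exact CMProof.injDimLT_ch _ k hk
    have hlow : ∀ k < rs.length, ¬ ResDimLE R (fun N => Module.Flat R N) k
        ((localCohomology (maximalIdeal R) rs.length).obj (ModuleCat.of R R)) := by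
      intro k hk hle
      rw [CMProof.resDimLE_flat_iff] at hle
      apply h8
      apply CMProof.subsingleton_of_ch
      refine CMProof.ext_descend _ rs (fun x hx => hT x (h5 x hx)) R h6.toIsWeaklyRegular 0 ?_
      intro N
      exact HasInjectiveDimensionLT.subsingleton _ (k+1) _ (by lia) N
    exact ⟨hfl.2 ⟨hmono _ hp, hlow⟩, hpr.2 ⟨hp, fun k hk h => hlow k hk (hmono k h)⟩⟩
  exact ⟨⟨fun h => (hC h).1, hA⟩, ⟨fun h => (hC (hA h)).2, fun h => (hC (hB h)).1⟩⟩
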